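/- arXiv:1701.02774 — 4 statements merged into one kernel-verified Lean document; each statement's English description precedes it below -/
import Mathlib

section
/- Let α ≤ γ in Clans_{p,q}, and suppose θ ∈ Clans_{r,s} pattern contains γ via indices I, with Φ(α) the unique clan pattern containing α via I and agreeing with θ outside I, and assume ℓ(θ) − ℓ(Φ(α)) = ℓ(γ) − ℓ(α). If α ⋖ α' ≤ γ, then [α',γ] interval pattern embeds into [Φ(α'),θ] via the same indices I; in particular Φ(α') ≤ θ and ℓ(θ) − ℓ(Φ(α')) = ℓ(γ) − ℓ(α'). -/
noncomputable section
open scoped Classical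

/-- A `(p,q)`-clan: a partial matching of `{0,…,p+q-1}` (encoded by the involution `mate`)
together with a sign (`true` = `+`, `false` = `-`) at each unmatched position, such that
`#(+) - #(-) = p - q`.  Matched positions carry the junk sign `true`. -/
structure Clan (p q : ℕ) where
  mate : Fin (p + q) → Fin (p + q)
  mate_invol : ∀ i, mate (mate i) = i
  sign : Fin (p + q) → Bool
  sign_matched : ∀ i, mate i ≠ i → sign i = true
  plus_minus :
    (Finset.univ.filter fun i => mate i = i ∧ sign i = true).card + q
      = (Finset.univ.filter fun i => mate i = i ∧ sign i = false).card + p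

namespace Clan

variable {p q r s : ℕ}

/-- position `i` carries a `+`. -/
def IsPlus (c : Clan p q) (i : Fin (p + q)) : Prop :=
  c.mate i = i ∧ c.sign i = true

/-- position `i` carries a `-`. -/
def IsMinus (c : Clan p q) (i : Fin (p + q)) : Prop :=
  c.mate i = i ∧ c.sign i = false

/-- position `i` is the left end of a matching. -/
def IsLeft (c : Clan p q) (i : Fin (p + q)) : Prop :=
  i < c.mate i

/-- position `i` is the right end of a matching. -/
def IsRight (c : Clan p q) (i : Fin (p + q)) : Prop :=
  c.mate i < i

/-- `(i < j)` is a matching of the clan `c`. -/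
def IsMatch (c : Clan p q) (i j : Fin (p + q)) : Prop :=
  i < j ∧ c.mate i = j

/-- The length `ℓ(c)` of a clan:
`ℓ(c) = Σ_{(i<j) matching} (j - i - #{matchings (s<t) with s < i < t < j})`. -/
def len (c : Clan p q) : ℤ :=
  ∑ ij ∈ Finset.univ.filter (fun ij : Fin (p + q) × Fin (p + q) => c.IsMatch ij.1 ij.2),
    (((ij.2 : ℕ) : ℤ) - ((ij.1 : ℕ) : ℤ) -
      ((Finset.univ.filter (fun st : Fin (p + q) × Fin (p + q) =>
          c.IsMatch st.1 st.2 ∧ st.1 < ij.1 ∧ ij.1 < st.2 ∧ st.2 < ij.2)).card : ℤ))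

/-- `c` and `c'` agree (same symbols, same matchings) at every position outside `S`. -/
def AgreeOutside (c c' : Clan p q) (S : Set (Fin (p + q))) : Prop :=
  ∀ i, i ∉ S → c.mate i = c'.mate i ∧ c.sign i = c'.sign i

/-- `c'` is obtained from `c` by one of the transpositions (T.1)–(T.10). -/
def Transposition (c c' : Clan p q) : Prop :=
  -- (T.1)  +- ↦ 11
  (∃ a b, a < b ∧ c.IsPlus a ∧ c.IsMinus b ∧ c'.IsMatch a b ∧
      AgreeOutside c c' {a, b}) ∨
  -- (T.2)  -+ ↦ 11
  (∃ a b, a < b ∧ c.IsMinus a ∧ c.IsPlus b ∧ c'.IsMatch a b ∧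
      AgreeOutside c c' {a, b}) ∨
  -- (T.3)  11+ ↦ 1+1
  (∃ a b d, c.IsMatch a b ∧ b < d ∧ c.IsPlus d ∧ c'.IsMatch a d ∧ c'.IsPlus b ∧
      AgreeOutside c c' {a, b, d}) ∨
  -- (T.4)  11- ↦ 1-1
  (∃ a b d, c.IsMatch a b ∧ b < d ∧ c.IsMinus d ∧ c'.IsMatch a d ∧ c'.IsMinus b ∧
      AgreeOutside c c' {a, b, d}) ∨
  -- (T.5)  +11 ↦ 1+1
  (∃ a b d, c.IsPlus a ∧ a < b ∧ c.IsMatch b d ∧ c'.IsMatch a d ∧ c'.IsPlus b ∧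
      AgreeOutside c c' {a, b, d}) ∨
  -- (T.6)  -11 ↦ 1-1
  (∃ a b d, c.IsMinus a ∧ a < b ∧ c.IsMatch b d ∧ c'.IsMatch a d ∧ c'.IsMinus b ∧
      AgreeOutside c c' {a, b, d}) ∨
  -- (T.7)  1122 ↦ 1212
  (∃ i j k l, c.IsMatch i j ∧ j < k ∧ c.IsMatch k l ∧ c'.IsMatch i k ∧ c'.IsMatch j l ∧
      AgreeOutside c c' {i, j, k, l}) ∨
  -- (T.8)  1122 ↦ 1+-1
  (∃ i j k l, c.IsMatch i j ∧ j < k ∧ c.IsMatch k l ∧ c'.IsMatch i l ∧ c'.IsPlus j ∧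
      c'.IsMinus k ∧ AgreeOutside c c' {i, j, k, l}) ∨
  -- (T.9)  1122 ↦ 1-+1
  (∃ i j k l, c.IsMatch i j ∧ j < k ∧ c.IsMatch k l ∧ c'.IsMatch i l ∧ c'.IsMinus j ∧
      c'.IsPlus k ∧ AgreeOutside c c' {i, j, k, l}) ∨
  -- (T.10) 1212 ↦ 1221
  (∃ i j k l, i < j ∧ j < k ∧ k < l ∧ c.IsMatch i k ∧ c.IsMatch j l ∧ c'.IsMatch i l ∧
      c'.IsMatch j k ∧ AgreeOutside c c' {i, j, k, l})

/-- Bruhat order `≤` on clans: generated by transpositions. -/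
def ble (c c' : Clan p q) : Prop :=
  Relation.ReflTransGen Transposition c c'

/-- Strict Bruhat order `<` on clans. -/
def blt (c c' : Clan p q) : Prop :=
  Relation.TransGen Transposition c c'

/-- Covering relation: `c ⋖ c'` iff `c < c'` and `ℓ(c') = ℓ(c) + 1`. -/
def Covers (c c' : Clan p q) : Prop :=
  blt c c' ∧ c'.len = c.len + 1

/-- `θ` pattern contains `γ` via the strictly increasing index map `ι`. -/
def Pattern (θ : Clan r s) (γ : Clan p q) (ι : Fin (p + q) → Fin (r + s)) : Prop :=
  StrictMono ι ∧
  (∀ j, γ.mate j = j → θ.mate (ι j) = ι j ∧ θ.sign (ι j) = γ.sign j) ∧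
  (∀ k l, γ.IsMatch k l → θ.IsMatch (ι k) (ι l))

/-- `φ` agrees with `θ` at every position outside the range of `ι`. -/
def AgreesWithOutside (φ θ : Clan r s) (ι : Fin (p + q) → Fin (r + s)) : Prop :=
  ∀ m, (∀ k, ι k ≠ m) → φ.mate m = θ.mate m ∧ φ.sign m = θ.sign m

/-- `[α,γ]` interval pattern embeds into `[β,θ]` via `ι`. -/
def IntervalEmbed (α γ : Clan p q) (β θ : Clan r s)
    (ι : Fin (p + q) → Fin (r + s)) : Prop :=
  Pattern θ γ ι ∧ Pattern β α ι ∧ AgreesWithOutside β θ ι ∧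
  θ.len - β.len = γ.len - α.len

/-- `θ` interval pattern contains `[α,γ]`. -/
def IntervalContains (θ : Clan r s) (α γ : Clan p q) : Prop :=
  ∃ (ι : Fin (p + q) → Fin (r + s)) (φ : Clan r s), IntervalEmbed α γ φ θ ι

/-- `γ(i;+)` (here `i` is the number of initial positions considered, i.e. `i` is 1-indexed):
number of `+`'s plus number of matchings entirely among the first `i` positions. -/
def statPlus (c : Clan p q) (i : ℕ) : ℕ :=
  (Finset.univ.filter fun j : Fin (p + q) => (j : ℕ) < i ∧ c.IsPlus j).card +
  (Finset.univ.filter fun ab : Fin (p + q) × Fin (p + q) =>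
      c.IsMatch ab.1 ab.2 ∧ (ab.2 : ℕ) < i).card

/-- `γ(i;-)`, as in `statPlus` with `-`'s. -/
def statMinus (c : Clan p q) (i : ℕ) : ℕ :=
  (Finset.univ.filter fun j : Fin (p + q) => (j : ℕ) < i ∧ c.IsMinus j).card +
  (Finset.univ.filter fun ab : Fin (p + q) × Fin (p + q) =>
      c.IsMatch ab.1 ab.2 ∧ (ab.2 : ℕ) < i).card

/-- `γ(i;j)` (with `i < j` 1-indexed): number of matchings with left endpoint weakly left
of `i` and right endpoint strictly right of `j`. -/
def statMid (c : Clan p q) (i j : ℕ) : ℕ :=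
  (Finset.univ.filter fun ab : Fin (p + q) × Fin (p + q) =>
      c.IsMatch ab.1 ab.2 ∧ (ab.1 : ℕ) < i ∧ j ≤ (ab.2 : ℕ)).card

/-- The permutation `w_c` associated to a clan `c`, 0-indexed: positions carrying a `+` or a
left endpoint get (in left-to-right order) the values `0,…,p-1`; the remaining values
`p,…,p+q-1` are assigned, scanning left to right, to each `-` as it is encountered and to the
right end of each matching as soon as its left end is encountered. -/
def wNat (c : Clan p q) (i : Fin (p + q)) : ℕ :=
  if c.IsPlus i ∨ c.IsLeft i then
    (Finset.univ.filter fun j : Fin (p + q) => (c.IsPlus j ∨ c.IsLeft j) ∧ j < i).card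
  else
    p + (Finset.univ.filter fun j : Fin (p + q) =>
        (c.IsMinus j ∨ c.IsLeft j) ∧ j < (if c.IsMinus i then i else c.mate i)).card

/-- Membership in the affine space `S_c`: the conditions (O.1)–(O.3) and (Z.1)–(Z.9). -/
def MemS (c : Clan p q) (M : Matrix (Fin (p + q)) (Fin (p + q)) ℂ) : Prop :=
  -- (O.1)
  (∀ i j : Fin (p + q), c.mate i = i → (j : ℕ) = c.wNat i → M i j = 1) ∧
  -- (O.2)
  (∀ i i' j : Fin (p + q), c.IsMatch i i' →
      ((j : ℕ) = c.wNat i ∨ (j : ℕ) = c.wNat i') → M i j = 1) ∧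
  -- (O.3)
  (∀ i i' j : Fin (p + q), c.IsMatch i i' → (j : ℕ) = c.wNat i → M i' j = -1) ∧
  (∀ i i' j : Fin (p + q), c.IsMatch i i' → (j : ℕ) = c.wNat i' → M i' j = 1) ∧
  -- (Z.1): first p columns, rows containing a pivot (rows of +'s and of left endpoints)
  (∀ i j : Fin (p + q), (c.IsPlus i ∨ c.IsLeft i) → (j : ℕ) < p →
      (j : ℕ) ≠ c.wNat i → M i j = 0) ∧
  -- (Z.2): above a pivot, first p columns
  (∀ i x j : Fin (p + q), (c.IsPlus i ∨ c.IsLeft i) → (j : ℕ) = c.wNat i →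
      x < i → M x j = 0) ∧
  -- (Z.3): between the pivot 1 and the -1 of a column
  (∀ i i' x j : Fin (p + q), c.IsMatch i i' → (j : ℕ) = c.wNat i →
      i < x → x < i' → M x j = 0) ∧
  -- (Z.4): right of a -1, within the first p columns
  (∀ i i' j : Fin (p + q), c.IsMatch i i' → c.wNat i < (j : ℕ) → (j : ℕ) < p →
      M i' j = 0) ∧
  -- (Z.5): last q columns, rows containing a pivot (rows of -'s and of left endpoints)
  (∀ i j : Fin (p + q), c.IsMinus i → p ≤ (j : ℕ) → (j : ℕ) ≠ c.wNat i → M i j = 0) ∧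
  (∀ i i' j : Fin (p + q), c.IsMatch i i' → p ≤ (j : ℕ) → (j : ℕ) ≠ c.wNat i' →
      M i j = 0) ∧
  -- (Z.6): above a pivot, last q columns
  (∀ i x j : Fin (p + q), c.IsMinus i → (j : ℕ) = c.wNat i → x < i → M x j = 0) ∧
  (∀ i i' x j : Fin (p + q), c.IsMatch i i' → (j : ℕ) = c.wNat i' → x < i → M x j = 0) ∧
  -- (Z.7): between the pivot 1 and the second 1 of a column
  (∀ i i' x j : Fin (p + q), c.IsMatch i i' → (j : ℕ) = c.wNat i' →
      i < x → x < i' → M x j = 0) ∧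
  -- (Z.8): right of a second-1-of-its-column
  (∀ i i' j : Fin (p + q), c.IsMatch i i' → c.wNat i' < (j : ℕ) → M i' j = 0) ∧
  -- (Z.9): identification for 1212 patterns
  (∀ i j k l ci ck : Fin (p + q), c.IsMatch i k → c.IsMatch j l →
      i < j → j < k → k < l → (ci : ℕ) = c.wNat i → (ck : ℕ) = c.wNat k →
      M l ck = - M l ci)

/-- Rank of the southwest `(n-i) × p` submatrix of `M` (`i` 1-indexed from `1` to `n`). -/
def swRank (p q : ℕ) (M : Matrix (Fin (p + q)) (Fin (p + q)) ℂ) (i : ℕ) : ℕ :=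
  Matrix.rank (Matrix.of fun (x : Fin (p + q - i)) (y : Fin p) =>
    M ⟨i + (x : ℕ), by have := x.isLt; omega⟩ ⟨(y : ℕ), by have := y.isLt; omega⟩)

/-- Rank of the southeast `(n-i) × q` submatrix of `M`. -/
def seRank (p q : ℕ) (M : Matrix (Fin (p + q)) (Fin (p + q)) ℂ) (i : ℕ) : ℕ :=
  Matrix.rank (Matrix.of fun (x : Fin (p + q - i)) (y : Fin q) =>
    M ⟨i + (x : ℕ), by have := x.isLt; omega⟩ ⟨p + (y : ℕ), by have := y.isLt; omega⟩)

/-- Rank of the auxiliary matrix `M^{[i;j]}`: its first `i` columns are the first `i` columns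
of `M⁻¹` with the last `q` rows zeroed out, its last `j` columns are the first `j` columns
of `M⁻¹`. -/
def auxRank (p q : ℕ) (M : Matrix (Fin (p + q)) (Fin (p + q)) ℂ) (i j : ℕ) : ℕ :=
  Matrix.rank (Matrix.of fun (x : Fin (p + q)) (y : Fin i ⊕ Fin j) =>
    Sum.elim
      (fun a : Fin i =>
        if p ≤ (x : ℕ) then (0 : ℂ)
        else if h : (a : ℕ) < p + q then M⁻¹ x ⟨(a : ℕ), h⟩ else 0)
      (fun b : Fin j =>
        if h : (b : ℕ) < p + q then M⁻¹ x ⟨(b : ℕ), h⟩ else 0) y)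

/-- The Mars–Springer variety `N_{θ,c}`: matrices of `S_c` satisfying the rank
conditions (R.1)–(R.3) attached to `θ`. -/
def MarsSpringer (θ c : Clan p q) (M : Matrix (Fin (p + q)) (Fin (p + q)) ℂ) : Prop :=
  MemS c M ∧
  (∀ i : ℕ, 1 ≤ i → i ≤ p + q → swRank p q M i ≤ p - statPlus θ i) ∧
  (∀ i : ℕ, 1 ≤ i → i ≤ p + q → seRank p q M i ≤ q - statMinus θ i) ∧
  (∀ i j : ℕ, 1 ≤ i → i < j → j ≤ p + q → auxRank p q M i j ≤ j + statMid θ i j)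

/-- The linear relations defining the coordinates `λ_{k,a}`:
`e_k + Σ_{a ≥ p} λ_{k,a} v_a = Σ_{a < p} λ_{k,a} v_a`, where `v_a` are the columns of `M`. -/
def LambdaRel (p q : ℕ) (M : Matrix (Fin (p + q)) (Fin (p + q)) ℂ)
    (lam : Fin (p + q) → Fin (p + q) → ℂ) : Prop :=
  ∀ k x : Fin (p + q),
    (if x = k then (1 : ℂ) else 0) +
        ∑ a ∈ Finset.univ.filter (fun a : Fin (p + q) => p ≤ (a : ℕ)), lam k a * M x a
      = ∑ a ∈ Finset.univ.filter (fun a : Fin (p + q) => (a : ℕ) < p), lam k a * M x a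

/-- The base point of `S_c`: all free entries set to `0`. -/
def basePoint (c : Clan p q) : Matrix (Fin (p + q)) (Fin (p + q)) ℂ :=
  Matrix.of fun i j =>
    if (j : ℕ) = c.wNat i then 1
    else if c.mate i ≠ i ∧ (j : ℕ) = c.wNat (c.mate i) then
      (if c.mate i < i then -1 else 1)
    else 0

/-- The diagonal matrix `I_{p,q}` with `p` ones followed by `q` negative ones. -/
def Ipq (p q : ℕ) : Matrix (Fin (p + q)) (Fin (p + q)) ℂ :=
  Matrix.diagonal fun i => if (i : ℕ) < p then 1 else -1

end Clan

namespace Clan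

variable {p q r s : ℕ}

lemma ext_mate_sign {c c' : Clan p q} (hm : ∀ i, c.mate i = c'.mate i)
    (hs : ∀ i, c.sign i = c'.sign i) : c = c' := by
  cases c
  cases c'
  obtain rfl := funext hm
  obtain rfl := funext hs
  rfl

lemma IsMatch.mate_left {c : Clan p q} {i j : Fin (p + q)} (h : c.IsMatch i j) :
    c.mate i = j := h.2

lemma IsMatch.mate_right {c : Clan p q} {i j : Fin (p + q)} (h : c.IsMatch i j) :
    c.mate j = i := by
  rw [← h.2, c.mate_invol]

/-- The matching involution of a clan as a permutation. -/
def matePerm (c : Clan p q) : Equiv.Perm (Fin (p + q)) :=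
  Function.Involutive.toPerm c.mate c.mate_invol

/-- The contribution to the length of the positions `a` and `b` with partners `a'` and `b'`:
`b` is counted if it lies in `(a, a']`, and discounted if it closes a matching that crosses
`(a, a')` from the left. -/
def pairTerm {n : ℕ} (a a' b b' : Fin n) : ℤ :=
  if a < a' then
    (if a < b ∧ b ≤ a' then 1 else 0) - (if b' < a ∧ a < b ∧ b < a' then 1 else 0)
  else 0

lemma len_eq_sum_pairTerm (c : Clan p q) :
    c.len = ∑ a, ∑ b, pairTerm a (c.mate a) b (c.mate b) := by
  unfold len
  rw [Finset.sum_filter, Fintype.sum_prod_type]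
  refine Finset.sum_congr rfl fun a _ => ?_
  rw [Finset.sum_eq_single (c.mate a) (fun b _ hb => if_neg fun h => hb h.2.symm)
    (fun h => absurd (Finset.mem_univ _) h)]
  by_cases h : a < c.mate a
  · have hm : c.IsMatch a (c.mate a) := ⟨h, rfl⟩
    simp only [pairTerm, if_pos hm, if_pos h, Finset.sum_sub_distrib, Finset.sum_boole]
    have hIoc : (Finset.univ.filter fun b => a < b ∧ b ≤ c.mate a) = Finset.Ioc a (c.mate a) := by
      ext b
      simp
    have hcard : (Finset.univ.filter (fun st : Fin (p + q) × Fin (p + q) =>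
          c.IsMatch st.1 st.2 ∧ st.1 < a ∧ a < st.2 ∧ st.2 < c.mate a)).card =
        (Finset.univ.filter fun b => c.mate b < a ∧ a < b ∧ b < c.mate a).card := by
      refine Finset.card_bij' (fun st _ => st.2) (fun b _ => (c.mate b, b)) ?_ ?_ ?_ ?_
      · rintro ⟨i, j⟩ hij
        simp only [Finset.mem_filter, Finset.mem_univ, true_and] at hij ⊢
        rw [hij.1.mate_right]
        exact hij.2
      · intro b hb
        simp only [Finset.mem_filter, Finset.mem_univ, true_and] at hb ⊢
        exact ⟨⟨hb.1.trans hb.2.1, c.mate_invol b⟩, hb⟩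
      · rintro ⟨i, j⟩ hij
        simp only [Finset.mem_filter, Finset.mem_univ, true_and] at hij ⊢
        rw [hij.1.mate_right]
      · intro b _
        rfl
    rw [hIoc, hcard, Fin.card_Ioc, Nat.cast_sub (le_of_lt h)]
  · have hm : ¬ c.IsMatch a (c.mate a) := fun h' => h h'.1
    simp [pairTerm, h, hm]

/-- The number of matchings that start at a position satisfying `P` and end at a position
satisfying `Q`. -/
def coverCount (c : Clan p q) (P Q : Fin (p + q) → Prop) : ℤ :=
  ∑ u, if P u ∧ Q (c.mate u) then 1 else 0

lemma coverCount_le_of_sum_le {c c' : Clan p q} {P Q : Fin (p + q) → Prop}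
    (S : Finset (Fin (p + q))) (h : ∀ i ∉ S, c.mate i = c'.mate i)
    (hS : ∑ u ∈ S, (if P u ∧ Q (c.mate u) then (1 : ℤ) else 0) ≤
      ∑ u ∈ S, if P u ∧ Q (c'.mate u) then 1 else 0) :
    c.coverCount P Q ≤ c'.coverCount P Q := by
  unfold coverCount
  rw [← Finset.sum_add_sum_compl S, ← Finset.sum_add_sum_compl S
    (fun u => if P u ∧ Q (c'.mate u) then (1 : ℤ) else 0)]
  refine add_le_add hS (Finset.sum_le_sum fun u hu => ?_)
  rw [h u (Finset.mem_compl.mp hu)]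

lemma coverCount_le_two {c c' : Clan p q} {P Q : Fin (p + q) → Prop}
    (hPQ : ∀ u, P u → ¬ Q u) {a b : Fin (p + q)} (hab : a < b)
    (ha : c.mate a = a) (hb : c.mate b = b) (h : AgreeOutside c c' {a, b}) :
    c.coverCount P Q ≤ c'.coverCount P Q := by
  refine coverCount_le_of_sum_le {a, b} (fun i hi => (h i (by simpa using hi)).1) ?_
  rw [Finset.sum_pair hab.ne, Finset.sum_pair hab.ne, ha, hb,
    if_neg (fun h => hPQ _ h.1 h.2), if_neg (fun h => hPQ _ h.1 h.2)]
  split_ifs <;> norm_num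

lemma coverCount_le_three {c c' : Clan p q} {P Q : Fin (p + q) → Prop}
    (hP : Antitone P) (hQ : Monotone Q) (hPQ : ∀ u, P u → ¬ Q u) {a b d : Fin (p + q)}
    (hab : a < b) (hbd : b < d)
    (hc : (c.mate a = b ∧ c.mate b = a ∧ c.mate d = d) ∨
      (c.mate a = a ∧ c.mate b = d ∧ c.mate d = b))
    (had' : c'.IsMatch a d) (hb' : c'.mate b = b) (h : AgreeOutside c c' {a, b, d}) :
    c.coverCount P Q ≤ c'.coverCount P Q := by
  have hs (f : Fin (p + q) → ℤ) : ∑ u ∈ ({a, b, d} : Finset (Fin (p + q))), f u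
      = f a + f b + f d := by
    rw [Finset.sum_insert (by simp [hab.ne, (hab.trans hbd).ne]), Finset.sum_pair hbd.ne,
      add_assoc]
  have hPab : P b → P a := hP hab.le
  have hPbd : P d → P b := hP hbd.le
  have hQab : Q a → Q b := hQ hab.le
  have hQbd : Q b → Q d := hQ hbd.le
  have h1 := hPQ a
  have h2 := hPQ b
  have h3 := hPQ d
  refine coverCount_le_of_sum_le {a, b, d} (fun i hi => (h i (by simpa using hi)).1) ?_
  rw [hs, hs, had'.mate_left, had'.mate_right, hb']
  rcases hc with ⟨ha, hb, hd⟩ | ⟨ha, hb, hd⟩ <;> rw [ha, hb, hd] <;> grind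

lemma coverCount_le_four {c c' : Clan p q} {P Q : Fin (p + q) → Prop}
    (hP : Antitone P) (hQ : Monotone Q) (hPQ : ∀ u, P u → ¬ Q u) {i j k l : Fin (p + q)}
    (hij : i < j) (hjk : j < k) (hkl : k < l)
    (hc : (c.IsMatch i j ∧ c.IsMatch k l ∧ c'.IsMatch i k ∧ c'.IsMatch j l) ∨
      (c.IsMatch i j ∧ c.IsMatch k l ∧ c'.IsMatch i l ∧ c'.mate j = j ∧ c'.mate k = k) ∨
      (c.IsMatch i k ∧ c.IsMatch j l ∧ c'.IsMatch i l ∧ c'.IsMatch j k))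
    (h : AgreeOutside c c' {i, j, k, l}) :
    c.coverCount P Q ≤ c'.coverCount P Q := by
  have hs (f : Fin (p + q) → ℤ) : ∑ u ∈ ({i, j, k, l} : Finset (Fin (p + q))), f u
      = f i + f j + f k + f l := by
    rw [Finset.sum_insert (by simp [hij.ne, (hij.trans hjk).ne, (hij.trans (hjk.trans hkl)).ne]),
      Finset.sum_insert (by simp [hjk.ne, (hjk.trans hkl).ne]), Finset.sum_pair hkl.ne]
    ring
  have hP1 : P j → P i := hP hij.le
  have hP2 : P k → P j := hP hjk.le
  have hP3 : P l → P k := hP hkl.le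
  have hQ1 : Q i → Q j := hQ hij.le
  have hQ2 : Q j → Q k := hQ hjk.le
  have hQ3 : Q k → Q l := hQ hkl.le
  have h1 := hPQ i
  have h2 := hPQ j
  have h3 := hPQ k
  have h4 := hPQ l
  refine coverCount_le_of_sum_le {i, j, k, l} (fun x hx => (h x (by simpa using hx)).1) ?_
  rw [hs, hs]
  rcases hc with ⟨m1, m2, m3, m4⟩ | ⟨m1, m2, m3, m4, m5⟩ | ⟨m1, m2, m3, m4⟩
  · rw [m1.mate_left, m1.mate_right, m2.mate_left, m2.mate_right, m3.mate_left, m3.mate_right,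
      m4.mate_left, m4.mate_right]
    grind
  · rw [m1.mate_left, m1.mate_right, m2.mate_left, m2.mate_right, m3.mate_left, m3.mate_right,
      m4, m5]
    grind
  · rw [m1.mate_left, m1.mate_right, m2.mate_left, m2.mate_right, m3.mate_left, m3.mate_right,
      m4.mate_left, m4.mate_right]
    grind

lemma Transposition.coverCount_le {c c' : Clan p q} (h : Transposition c c')
    {P Q : Fin (p + q) → Prop} (hP : Antitone P) (hQ : Monotone Q) (hPQ : ∀ u, P u → ¬ Q u) :
    c.coverCount P Q ≤ c'.coverCount P Q := by
  rcases h with ⟨a, b, hab, ha, hb, -, ho⟩ | ⟨a, b, hab, ha, hb, -, ho⟩ |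
    ⟨a, b, d, hab, hbd, hd, had', hb', ho⟩ | ⟨a, b, d, hab, hbd, hd, had', hb', ho⟩ |
    ⟨a, b, d, ha, hab, hbd, had', hb', ho⟩ | ⟨a, b, d, ha, hab, hbd, had', hb', ho⟩ |
    ⟨i, j, k, l, hij, hjk, hkl, h1, h2, ho⟩ | ⟨i, j, k, l, hij, hjk, hkl, h1, h2, h3, ho⟩ |
    ⟨i, j, k, l, hij, hjk, hkl, h1, h2, h3, ho⟩ |
    ⟨i, j, k, l, hij, hjk, hkl, h1, h2, h3, h4, ho⟩
  · exact coverCount_le_two hPQ hab ha.1 hb.1 ho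
  · exact coverCount_le_two hPQ hab ha.1 hb.1 ho
  · exact coverCount_le_three hP hQ hPQ hab.1 hbd (.inl ⟨hab.2, hab.mate_right, hd.1⟩)
      had' hb'.1 ho
  · exact coverCount_le_three hP hQ hPQ hab.1 hbd (.inl ⟨hab.2, hab.mate_right, hd.1⟩)
      had' hb'.1 ho
  · exact coverCount_le_three hP hQ hPQ hab hbd.1 (.inr ⟨ha.1, hbd.2, hbd.mate_right⟩)
      had' hb'.1 ho
  · exact coverCount_le_three hP hQ hPQ hab hbd.1 (.inr ⟨ha.1, hbd.2, hbd.mate_right⟩)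
      had' hb'.1 ho
  · exact coverCount_le_four hP hQ hPQ hij.1 hjk hkl.1 (.inl ⟨hij, hkl, h1, h2⟩) ho
  · exact coverCount_le_four hP hQ hPQ hij.1 hjk hkl.1
      (.inr (.inl ⟨hij, hkl, h1, h2.1, h3.1⟩)) ho
  · exact coverCount_le_four hP hQ hPQ hij.1 hjk hkl.1
      (.inr (.inl ⟨hij, hkl, h1, h2.1, h3.1⟩)) ho
  · exact coverCount_le_four hP hQ hPQ hij hjk hkl (.inr (.inr ⟨h1, h2, h3, h4⟩)) ho

lemma Pattern.mate_apply {θ : Clan r s} {γ : Clan p q} {ι : Fin (p + q) → Fin (r + s)}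
    (h : Pattern θ γ ι) (k : Fin (p + q)) : θ.mate (ι k) = ι (γ.mate k) := by
  rcases lt_trichotomy k (γ.mate k) with hk | hk | hk
  · exact (h.2.2 k _ ⟨hk, rfl⟩).2
  · rw [(h.2.1 k hk.symm).1, ← hk]
  · exact (h.2.2 _ k ⟨hk, γ.mate_invol k⟩).mate_right

lemma Pattern.sign_apply {θ : Clan r s} {γ : Clan p q} {ι : Fin (p + q) → Fin (r + s)}
    (h : Pattern θ γ ι) (k : Fin (p + q)) : θ.sign (ι k) = γ.sign k := by
  by_cases hk : γ.mate k = k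
  · exact (h.2.1 k hk).2
  · rw [γ.sign_matched k hk, θ.sign_matched]
    rw [h.mate_apply]
    exact fun h' => hk (h.1.injective h')

lemma Pattern.mate_not_mem_range {θ : Clan r s} {γ : Clan p q} {ι : Fin (p + q) → Fin (r + s)}
    (h : Pattern θ γ ι) {m : Fin (r + s)} (hm : m ∉ Set.range ι) : θ.mate m ∉ Set.range ι := by
  rintro ⟨k, hk⟩
  exact hm ⟨γ.mate k, by rw [← h.mate_apply, hk, θ.mate_invol]⟩

lemma sum_eq_sum_comp_add_sum_compl_range {M : Type*} [AddCommMonoid M] {m n : ℕ}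
    {ι : Fin m → Fin n} (hι : Function.Injective ι) (f : Fin n → M) :
    ∑ x, f x = ∑ k, f (ι k) + ∑ x ∈ Finset.univ.filter (· ∉ Set.range ι), f x := by
  rw [← Finset.sum_filter_add_sum_filter_not Finset.univ (· ∈ Set.range ι)]
  congr 1
  rw [← Finset.sum_image (g := ι) (fun a _ b _ h => hι h)]
  congr 1
  ext x
  simp

/-- The clan obtained from `θ` by replacing the symbols on the range of `ι`, where `θ` contains
the pattern `γ`, by those of `β`. -/
def replacePattern {θ : Clan r s} {γ : Clan p q} {ι : Fin (p + q) → Fin (r + s)}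
    (h : Pattern θ γ ι) (β : Clan p q) : Clan r s where
  mate := Function.extend ι (fun k => ι (β.mate k)) θ.mate
  sign := Function.extend ι β.sign θ.sign
  mate_invol m := by
    by_cases hm : m ∈ Set.range ι
    · obtain ⟨k, rfl⟩ := hm
      simp [h.1.injective.extend_apply, β.mate_invol]
    · rw [Function.extend_apply' _ _ m hm, Function.extend_apply' _ _ _ (h.mate_not_mem_range hm),
        θ.mate_invol]
  sign_matched m := by
    by_cases hm : m ∈ Set.range ι
    · obtain ⟨k, rfl⟩ := hm
      simp only [h.1.injective.extend_apply]
      exact fun hk => β.sign_matched k fun h' => hk (by rw [h'])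
    · rw [Function.extend_apply' _ _ m hm, Function.extend_apply' _ _ m hm]
      exact θ.sign_matched m
  plus_minus := by
    have hθ := θ.plus_minus
    have hγ := γ.plus_minus
    have hβ := β.plus_minus
    simp only [Finset.card_filter] at hθ hγ hβ ⊢
    rw [sum_eq_sum_comp_add_sum_compl_range h.1.injective,
      sum_eq_sum_comp_add_sum_compl_range h.1.injective
        (fun i => if θ.mate i = i ∧ θ.sign i = false then 1 else 0)] at hθ
    rw [sum_eq_sum_comp_add_sum_compl_range h.1.injective,
      sum_eq_sum_comp_add_sum_compl_range h.1.injective (fun i =>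
        if Function.extend ι (fun k => ι (β.mate k)) θ.mate i = i ∧
          Function.extend ι β.sign θ.sign i = false then 1 else 0)]
    have hO (b : Bool) : ∑ x ∈ Finset.univ.filter (· ∉ Set.range ι),
        (if Function.extend ι (fun k => ι (β.mate k)) θ.mate x = x ∧
          Function.extend ι β.sign θ.sign x = b then 1 else 0) =
        ∑ x ∈ Finset.univ.filter (· ∉ Set.range ι),
          if θ.mate x = x ∧ θ.sign x = b then 1 else 0 := by
      refine Finset.sum_congr rfl fun x hx => ?_
      have hx' := (Finset.mem_filter.mp hx).2
      rw [Function.extend_apply' _ _ x hx', Function.extend_apply' _ _ x hx']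
    rw [hO, hO]
    simp only [h.mate_apply, h.sign_apply, h.1.injective.extend_apply,
      h.1.injective.eq_iff] at hθ ⊢
    omega


section ReplacePattern

variable {θ : Clan r s} {γ : Clan p q} {ι : Fin (p + q) → Fin (r + s)} (h : Pattern θ γ ι)

include h

lemma replacePattern_mate_apply (β : Clan p q) (k : Fin (p + q)) :
    (replacePattern h β).mate (ι k) = ι (β.mate k) :=
  h.1.injective.extend_apply (fun k => ι (β.mate k)) θ.mate k

lemma replacePattern_sign_apply (β : Clan p q) (k : Fin (p + q)) :
    (replacePattern h β).sign (ι k) = β.sign k :=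
  h.1.injective.extend_apply _ _ _

lemma replacePattern_mate_of_not_mem (β : Clan p q) {m : Fin (r + s)} (hm : m ∉ Set.range ι) :
    (replacePattern h β).mate m = θ.mate m :=
  Function.extend_apply' (fun k => ι (β.mate k)) θ.mate m hm

lemma replacePattern_sign_of_not_mem (β : Clan p q) {m : Fin (r + s)} (hm : m ∉ Set.range ι) :
    (replacePattern h β).sign m = θ.sign m :=
  Function.extend_apply' _ _ m hm

lemma eq_replacePattern {φ : Clan r s} {β : Clan p q} (hφ : Pattern φ β ι)
    (ho : AgreesWithOutside φ θ ι) : φ = replacePattern h β := by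
  refine ext_mate_sign (fun m => ?_) (fun m => ?_) <;> by_cases hm : m ∈ Set.range ι
  · obtain ⟨k, rfl⟩ := hm
    rw [hφ.mate_apply, replacePattern_mate_apply]
  · rw [replacePattern_mate_of_not_mem h β hm]
    exact (ho m fun k hk => hm ⟨k, hk⟩).1
  · obtain ⟨k, rfl⟩ := hm
    rw [hφ.sign_apply, replacePattern_sign_apply]
  · rw [replacePattern_sign_of_not_mem h β hm]
    exact (ho m fun k hk => hm ⟨k, hk⟩).2

lemma IsPlus.replacePattern {β : Clan p q} {i : Fin (p + q)} (hi : β.IsPlus i) :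
    (replacePattern h β).IsPlus (ι i) :=
  ⟨by rw [replacePattern_mate_apply, hi.1], by rw [replacePattern_sign_apply, hi.2]⟩

lemma IsMinus.replacePattern {β : Clan p q} {i : Fin (p + q)} (hi : β.IsMinus i) :
    (replacePattern h β).IsMinus (ι i) :=
  ⟨by rw [replacePattern_mate_apply, hi.1], by rw [replacePattern_sign_apply, hi.2]⟩

lemma IsMatch.replacePattern {β : Clan p q} {i j : Fin (p + q)} (hij : β.IsMatch i j) :
    (replacePattern h β).IsMatch (ι i) (ι j) :=
  ⟨h.1 hij.1, by rw [replacePattern_mate_apply, hij.2]⟩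

lemma AgreeOutside.replacePattern {c c' : Clan p q} {S : Set (Fin (p + q))}
    (ho : AgreeOutside c c' S) :
    AgreeOutside (replacePattern h c) (replacePattern h c') (ι '' S) := by
  intro m hm
  by_cases hr : m ∈ Set.range ι
  · obtain ⟨k, rfl⟩ := hr
    have hk := ho k fun hk => hm ⟨k, hk, rfl⟩
    simp only [replacePattern_mate_apply, replacePattern_sign_apply, hk, and_self]
  · simp only [replacePattern_mate_of_not_mem h _ hr, replacePattern_sign_of_not_mem h _ hr,
      and_self]

lemma Transposition.replacePattern {c c' : Clan p q} (ht : Transposition c c') :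
    Transposition (replacePattern h c) (replacePattern h c') := by
  rcases ht with ⟨a, b, h1, h2, h3, h4, ho⟩ | ⟨a, b, h1, h2, h3, h4, ho⟩ |
    ⟨a, b, d, h1, h2, h3, h4, h5, ho⟩ | ⟨a, b, d, h1, h2, h3, h4, h5, ho⟩ |
    ⟨a, b, d, h1, h2, h3, h4, h5, ho⟩ | ⟨a, b, d, h1, h2, h3, h4, h5, ho⟩ |
    ⟨i, j, k, l, h1, h2, h3, h4, h5, ho⟩ | ⟨i, j, k, l, h1, h2, h3, h4, h5, h6, ho⟩ |
    ⟨i, j, k, l, h1, h2, h3, h4, h5, h6, ho⟩ |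
    ⟨i, j, k, l, h1, h2, h3, h4, h5, h6, h7, ho⟩ <;>
    have ho' := ho.replacePattern h <;>
    simp only [Set.image_insert_eq, Set.image_singleton] at ho'
  · exact .inl ⟨_, _, h.1 h1, h2.replacePattern h, h3.replacePattern h, h4.replacePattern h, ho'⟩
  · exact .inr <| .inl ⟨_, _, h.1 h1, h2.replacePattern h, h3.replacePattern h,
      h4.replacePattern h, ho'⟩
  · exact .inr <| .inr <| .inl ⟨_, _, _, h1.replacePattern h, h.1 h2, h3.replacePattern h,
      h4.replacePattern h, h5.replacePattern h, ho'⟩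
  · exact .inr <| .inr <| .inr <| .inl ⟨_, _, _, h1.replacePattern h, h.1 h2,
      h3.replacePattern h, h4.replacePattern h, h5.replacePattern h, ho'⟩
  · exact .inr <| .inr <| .inr <| .inr <| .inl ⟨_, _, _, h1.replacePattern h, h.1 h2,
      h3.replacePattern h, h4.replacePattern h, h5.replacePattern h, ho'⟩
  · exact .inr <| .inr <| .inr <| .inr <| .inr <| .inl ⟨_, _, _, h1.replacePattern h, h.1 h2,
      h3.replacePattern h, h4.replacePattern h, h5.replacePattern h, ho'⟩
  · exact .inr <| .inr <| .inr <| .inr <| .inr <| .inr <| .inl ⟨_, _, _, _,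
      h1.replacePattern h, h.1 h2, h3.replacePattern h, h4.replacePattern h,
      h5.replacePattern h, ho'⟩
  · exact .inr <| .inr <| .inr <| .inr <| .inr <| .inr <| .inr <| .inl ⟨_, _, _, _,
      h1.replacePattern h, h.1 h2, h3.replacePattern h, h4.replacePattern h,
      h5.replacePattern h, h6.replacePattern h, ho'⟩
  · exact .inr <| .inr <| .inr <| .inr <| .inr <| .inr <| .inr <| .inr <| .inl ⟨_, _, _, _,
      h1.replacePattern h, h.1 h2, h3.replacePattern h, h4.replacePattern h,
      h5.replacePattern h, h6.replacePattern h, ho'⟩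
  · exact .inr <| .inr <| .inr <| .inr <| .inr <| .inr <| .inr <| .inr <| .inr ⟨_, _, _, _,
      h.1 h1, h.1 h2, h.1 h3, h4.replacePattern h, h5.replacePattern h, h6.replacePattern h,
      h7.replacePattern h, ho'⟩

lemma ble.replacePattern {c c' : Clan p q} (hc : ble c c') :
    ble (replacePattern h c) (replacePattern h c') :=
  Relation.ReflTransGen.lift (Clan.replacePattern h)
    (fun _ _ ht => Transposition.replacePattern h ht) _ _ hc

lemma sum_pairTerm_mixed (β : Clan p q) {m : Fin (r + s)} (hm : m ∉ Set.range ι) :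
    ∑ k, (pairTerm (ι k) (ι (β.mate k)) m (θ.mate m) +
        pairTerm m (θ.mate m) (ι k) (ι (β.mate k))) =
      (∑ k, if m < θ.mate m ∧ m < ι k ∧ ι k ≤ θ.mate m then 1 else 0) +
        β.coverCount (fun u => ι u < min m (θ.mate m)) (fun u => max m (θ.mate m) < ι u) := by
  have hne (k) : ι k ≠ m := fun hk => hm ⟨k, hk⟩
  have hne' (k) : ι k ≠ θ.mate m := fun hk => h.mate_not_mem_range hm ⟨k, hk⟩
  unfold coverCount
  rcases lt_or_ge m (θ.mate m) with hlt | hge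
  · have key (k) : pairTerm (ι k) (ι (β.mate k)) m (θ.mate m) +
        pairTerm m (θ.mate m) (ι k) (ι (β.mate k)) =
        (if m < θ.mate m ∧ m < ι k ∧ ι k ≤ θ.mate m then 1 else 0) +
        ((if ι k < m ∧ m < ι (β.mate k) then 1 else 0) -
          if ι (β.mate k) < m ∧ m < ι k ∧ ι k < θ.mate m then 1 else 0) := by
      have h1 := hne (β.mate k)
      unfold pairTerm
      grind
    have hswap : ∑ k, (if ι (β.mate k) < m ∧ m < ι k ∧ ι k < θ.mate m then (1 : ℤ) else 0) =
        ∑ k, if ι k < m ∧ m < ι (β.mate k) ∧ ι (β.mate k) < θ.mate m then 1 else 0 := by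
      rw [← Equiv.sum_comp β.matePerm]
      refine Finset.sum_congr rfl fun k _ => ?_
      change (if ι (β.mate (β.mate k)) < m ∧ m < ι (β.mate k) ∧ ι (β.mate k) < θ.mate m
        then (1 : ℤ) else 0) = _
      rw [β.mate_invol]
    simp only [key, Finset.sum_add_distrib]
    rw [Finset.sum_sub_distrib, hswap, ← Finset.sum_sub_distrib]
    congr 1
    refine Finset.sum_congr rfl fun k _ => ?_
    rw [min_eq_left hlt.le, max_eq_right hlt.le]
    have h2 := hne' (β.mate k)
    grind
  · rw [← Finset.sum_add_distrib]
    refine Finset.sum_congr rfl fun k _ => ?_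
    rw [min_eq_right hge, max_eq_left hge]
    have h1 := hne (β.mate k)
    have h2 := hne' k
    unfold pairTerm
    grind

lemma exists_len_replacePattern_eq : ∃ C : ℤ, ∀ β : Clan p q,
    (replacePattern h β).len = β.len + C + ∑ m ∈ Finset.univ.filter (· ∉ Set.range ι),
      β.coverCount (fun u => ι u < min m (θ.mate m)) (fun u => max m (θ.mate m) < ι u) := by
  refine ⟨∑ a ∈ Finset.univ.filter (· ∉ Set.range ι), ∑ b ∈ Finset.univ.filter (· ∉ Set.range ι),
      pairTerm a (θ.mate a) b (θ.mate b) +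
    ∑ m ∈ Finset.univ.filter (· ∉ Set.range ι),
      ∑ k, if m < θ.mate m ∧ m < ι k ∧ ι k ≤ θ.mate m then 1 else 0, fun β => ?_⟩
  have hO {m : Fin (r + s)} (hm : m ∈ Finset.univ.filter (· ∉ Set.range ι)) :
      m ∉ Set.range ι := (Finset.mem_filter.mp hm).2
  have hinner (a a' : Fin (r + s)) :
      ∑ b, pairTerm a a' b ((replacePattern h β).mate b) =
      ∑ k, pairTerm a a' (ι k) (ι (β.mate k)) +
        ∑ b ∈ Finset.univ.filter (· ∉ Set.range ι), pairTerm a a' b (θ.mate b) := by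
    rw [sum_eq_sum_comp_add_sum_compl_range h.1.injective]
    congr 1
    · simp only [replacePattern_mate_apply]
    · exact Finset.sum_congr rfl fun b hb => by rw [replacePattern_mate_of_not_mem h β (hO hb)]
  have hmixed : ∑ k, ∑ m ∈ Finset.univ.filter (· ∉ Set.range ι),
        pairTerm (ι k) (ι (β.mate k)) m (θ.mate m) +
      ∑ m ∈ Finset.univ.filter (· ∉ Set.range ι),
        ∑ k, pairTerm m (θ.mate m) (ι k) (ι (β.mate k)) =
      ∑ m ∈ Finset.univ.filter (· ∉ Set.range ι),
        ((∑ k, if m < θ.mate m ∧ m < ι k ∧ ι k ≤ θ.mate m then 1 else 0) +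
        β.coverCount (fun u => ι u < min m (θ.mate m)) (fun u => max m (θ.mate m) < ι u)) := by
    rw [Finset.sum_comm, ← Finset.sum_add_distrib]
    refine Finset.sum_congr rfl fun m hm => ?_
    rw [← sum_pairTerm_mixed h β (hO hm), Finset.sum_add_distrib]
  have hin : β.len = ∑ k, ∑ l, pairTerm (ι k) (ι (β.mate k)) (ι l) (ι (β.mate l)) := by
    simp only [len_eq_sum_pairTerm, pairTerm, h.1.lt_iff_lt, h.1.le_iff_le]
  have hout : ∑ m ∈ Finset.univ.filter (· ∉ Set.range ι),
        ∑ b, pairTerm m ((replacePattern h β).mate m) b ((replacePattern h β).mate b) =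
      ∑ m ∈ Finset.univ.filter (· ∉ Set.range ι),
        (∑ k, pairTerm m (θ.mate m) (ι k) (ι (β.mate k)) +
          ∑ b ∈ Finset.univ.filter (· ∉ Set.range ι), pairTerm m (θ.mate m) b (θ.mate b)) :=
    Finset.sum_congr rfl fun m hm => by
      rw [hinner, replacePattern_mate_of_not_mem h β (hO hm)]
  rw [len_eq_sum_pairTerm, sum_eq_sum_comp_add_sum_compl_range h.1.injective, hout, hin]
  simp only [hinner, replacePattern_mate_apply, Finset.sum_add_distrib] at hmixed ⊢
  linarith

/-- The excess of the length of the replaced clan over that of the replacing pattern is weakly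
increasing in the Bruhat order. -/
lemma ble.len_replacePattern_sub_len_le {c c' : Clan p q} (hc : ble c c') :
    (Clan.replacePattern h c).len - c.len ≤ (Clan.replacePattern h c').len - c'.len := by
  induction hc with
  | refl => exact le_rfl
  | tail _ ht ih =>
    refine ih.trans ?_
    obtain ⟨C, hC⟩ := exists_len_replacePattern_eq h
    rw [hC, hC, add_assoc, add_assoc, add_sub_cancel_left, add_sub_cancel_left]
    gcongr with m
    refine ht.coverCount_le (fun u v huv hv => (h.1.monotone huv).trans_lt hv)
      (fun u v huv hu => hu.trans_le (h.1.monotone huv)) fun u hu hu' => ?_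
    exact absurd (hu.trans_le min_le_max) hu'.not_gt

end ReplacePattern

end Clan

/-- given an interval pattern embedding of `[α,γ]` into `[Φ(α),θ]`,
if `α ⋖ α' ≤ γ` then `[α',γ]` interval pattern embeds into `[Φ(α'),θ]` via the same
indices: `Φ(α') ≤ θ` and `ℓ(θ) - ℓ(Φ(α')) = ℓ(γ) - ℓ(α')`. -/
theorem interval_embed_up {p q r s : ℕ} (α α' γ : Clan p q) (θ φα φα' : Clan r s)
    (ι : Fin (p + q) → Fin (r + s))
    (hαγ : Clan.ble α γ)
    (hθγ : Clan.Pattern θ γ ι)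
    (hφα : Clan.Pattern φα α ι)
    (hout : Clan.AgreesWithOutside φα θ ι)
    (hlen : θ.len - φα.len = γ.len - α.len)
    (hcov : Clan.Covers α α') (hα'γ : Clan.ble α' γ)
    (hφα' : Clan.Pattern φα' α' ι)
    (hout' : Clan.AgreesWithOutside φα' θ ι) :
    Clan.ble φα' θ ∧ θ.len - φα'.len = γ.len - α'.len := by
  obtain rfl := Clan.eq_replacePattern hθγ hφα hout
  obtain rfl := Clan.eq_replacePattern hθγ hφα' hout'
  have hθ := Clan.eq_replacePattern hθγ hθγ fun m _ => ⟨rfl, rfl⟩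
  have h1 := Clan.ble.len_replacePattern_sub_len_le hθγ hcov.1.to_reflTransGen
  have h2 := Clan.ble.len_replacePattern_sub_len_le hθγ hα'γ
  have h3 := Clan.ble.replacePattern hθγ hα'γ
  rw [← hθ] at h2 h3
  exact ⟨h3, by linarith⟩
end
end

section
/- Let α ≤ α' ≤ γ in Clans_{p,q} and θ ∈ Clans_{r,s}. If θ avoids the interval [α',γ] (i.e., θ does not interval pattern contain [α',γ]), then θ avoids the interval [α,γ]. -/
noncomputable section
open scoped Classical

namespace Clan

theorem mate_injective {p q : ℕ} (c : Clan p q) : Function.Injective c.mate :=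
  Function.LeftInverse.injective c.mate_invol

/-- The contribution of a matching `(i < j)` to the length, as a count of the positions in
`(i, j]` whose mate is not to the left of `i`. -/
theorem len_term {p q : ℕ} (c : Clan p q) {i j : Fin (p + q)} (h : c.IsMatch i j) :
    (((j : ℕ) : ℤ) - ((i : ℕ) : ℤ) -
      ((Finset.univ.filter (fun st : Fin (p + q) × Fin (p + q) =>
          c.IsMatch st.1 st.2 ∧ st.1 < i ∧ i < st.2 ∧ st.2 < j)).card : ℤ)) =
    ∑ m, if i < m ∧ m ≤ j ∧ i ≤ c.mate m then 1 else 0 := by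
  obtain ⟨hij, hmate⟩ := h
  have hmate' : c.mate j = i := by rw [← hmate, c.mate_invol]
  have hcross : (Finset.univ.filter (fun st : Fin (p + q) × Fin (p + q) =>
      c.IsMatch st.1 st.2 ∧ st.1 < i ∧ i < st.2 ∧ st.2 < j)).card =
      ((Finset.Ioc i j).filter fun m => ¬ i ≤ c.mate m).card := by
    refine Finset.card_bij (fun st _ => st.2) ?_ ?_ ?_
    · rintro ⟨s, t⟩ hst
      simp only [Finset.mem_filter, Finset.mem_univ, true_and, Finset.mem_Ioc] at hst ⊢
      obtain ⟨⟨-, rfl⟩, h1, h2, h3⟩ := hst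
      rw [c.mate_invol]
      exact ⟨⟨h2, h3.le⟩, not_le.2 h1⟩
    · rintro ⟨s, t⟩ hst ⟨s', t'⟩ hst' heq
      simp only [Finset.mem_filter, Finset.mem_univ, true_and] at hst hst' heq
      rw [Prod.mk.injEq]
      exact ⟨c.mate_injective (by rw [hst.1.2, hst'.1.2, heq]), heq⟩
    · intro m hm
      simp only [Finset.mem_filter, Finset.mem_Ioc, not_le] at hm
      refine ⟨(c.mate m, m), ?_, rfl⟩
      simp only [Finset.mem_filter, Finset.mem_univ, true_and]
      refine ⟨⟨hm.2.trans hm.1.1, c.mate_invol m⟩, hm.2, hm.1.1, lt_of_le_of_ne hm.1.2 ?_⟩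
      rintro rfl
      exact absurd hm.2 (by rw [hmate']; exact lt_irrefl _)
  have hsplit := Finset.card_filter_add_card_filter_not (s := Finset.Ioc i j)
    (fun m => i ≤ c.mate m)
  have hfilter : (Finset.univ.filter fun m => i < m ∧ m ≤ j ∧ i ≤ c.mate m) =
      (Finset.Ioc i j).filter fun m => i ≤ c.mate m := by
    ext m
    simp [and_assoc]
  rw [Finset.sum_boole, hfilter, hcross]
  rw [Fin.card_Ioc] at hsplit
  have : (i : ℕ) < j := hij
  omega

theorem len_eq_sum {p q : ℕ} (c : Clan p q) :
    c.len = ∑ i, ∑ m, if i < m ∧ m ≤ c.mate i ∧ i ≤ c.mate m then 1 else 0 := by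
  unfold len
  rw [Finset.sum_congr rfl fun ij hij => c.len_term (Finset.mem_filter.1 hij).2,
    Finset.sum_filter, Fintype.sum_prod_type]
  refine Finset.sum_congr rfl fun i _ => ?_
  rw [Finset.sum_eq_single (c.mate i)]
  · split_ifs with h
    · rfl
    · symm
      refine Finset.sum_eq_zero fun m _ => if_neg ?_
      rintro ⟨h1, h2, -⟩
      exact h ⟨h1.trans_le h2, rfl⟩
  · intro j _ hj
    exact if_neg fun h => hj h.2.symm
  · simp

theorem Pattern.mate_eq {p q r s : ℕ} {θ : Clan r s} {γ : Clan p q}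
    {ι : Fin (p + q) → Fin (r + s)} (h : Pattern θ γ ι) (k : Fin (p + q)) :
    θ.mate (ι k) = ι (γ.mate k) := by
  rcases lt_trichotomy k (γ.mate k) with hk | hk | hk
  · exact (h.2.2 k _ ⟨hk, rfl⟩).2
  · rw [← hk]
    exact (h.2.1 k hk.symm).1
  · have := (h.2.2 (γ.mate k) k ⟨hk, γ.mate_invol k⟩).2
    rw [← this, θ.mate_invol]

theorem Pattern.sign_eq {p q r s : ℕ} {θ : Clan r s} {γ : Clan p q}
    {ι : Fin (p + q) → Fin (r + s)} (h : Pattern θ γ ι) (k : Fin (p + q)) :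
    θ.sign (ι k) = γ.sign k := by
  by_cases hk : γ.mate k = k
  · exact (h.2.1 k hk).2
  · rw [γ.sign_matched k hk, θ.sign_matched]
    rw [h.mate_eq]
    exact fun h' => hk (h.1.injective h')

theorem Pattern.mate_notMem_range {p q r s : ℕ} {θ : Clan r s} {γ : Clan p q}
    {ι : Fin (p + q) → Fin (r + s)} (h : Pattern θ γ ι) {m : Fin (r + s)}
    (hm : m ∉ Set.range ι) : θ.mate m ∉ Set.range ι := by
  rintro ⟨k, hk⟩
  refine hm ⟨γ.mate k, ?_⟩
  rw [← h.mate_eq, hk, θ.mate_invol]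

end Clan

theorem Fintype.sum_eq_sum_range_add {κ ν M : Type*} [Fintype κ] [Fintype ν] [AddCommMonoid M]
    {ι : κ → ν} [DecidablePred (· ∉ Set.range ι)] (hι : Function.Injective ι) (f : ν → M) :
    ∑ x, f x = ∑ k, f (ι k) + ∑ x ∈ Finset.univ.filter (· ∉ Set.range ι), f x := by
  rw [← Finset.sum_filter_add_sum_filter_not Finset.univ (· ∉ Set.range ι), add_comm]
  congr 1
  rw [← Finset.sum_image (g := ι) (f := f) (fun _ _ _ _ h => hι h)]
  refine Finset.sum_congr ?_ fun _ _ => rfl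
  ext x
  simp

namespace Clan

/-- The number of matchings of `c` which, placed at positions `ι`, enclose both `a` and `b`. -/
def enclosing {p q n : ℕ} (c : Clan p q) (ι : Fin (p + q) → Fin n) (a b : Fin n) : ℤ :=
  ∑ k, if ι k < a ∧ ι k < b ∧ a < ι (c.mate k) ∧ b < ι (c.mate k) then 1 else 0

theorem len_eq_of_agreesWithOutside {p q r s : ℕ} {β θ : Clan r s} {α γ : Clan p q}
    {ι : Fin (p + q) → Fin (r + s)} (hθ : Pattern θ γ ι) (hβ : Pattern β α ι)
    (hout : AgreesWithOutside β θ ι) :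
    β.len = α.len +
      ∑ m ∈ Finset.univ.filter (· ∉ Set.range ι),
        ((∑ k, if m < ι k ∧ ι k < θ.mate m then 1 else 0) +
          (∑ x ∈ Finset.univ.filter (· ∉ Set.range ι),
            if m < x ∧ x ≤ θ.mate m ∧ m ≤ θ.mate x then 1 else 0) +
          α.enclosing ι m (θ.mate m)) := by
  have hmate : ∀ m, m ∉ Set.range ι → β.mate m = θ.mate m := fun m hm =>
    (hout m fun k hk => hm ⟨k, hk⟩).1
  have hinj := hβ.1.injective
  rw [len_eq_sum, Fintype.sum_eq_sum_range_add hinj]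
  simp_rw [Fintype.sum_eq_sum_range_add hinj (fun x => ite (_ < x ∧ _) _ _)]
  rw [Finset.sum_add_distrib, add_assoc, Finset.sum_comm (s := Finset.univ)
    (t := Finset.univ.filter (· ∉ Set.range ι)), ← Finset.sum_add_distrib]
  congr 1
  · rw [len_eq_sum]
    simp_rw [hβ.mate_eq, hβ.1.lt_iff_lt, hβ.1.le_iff_le]
  · refine Finset.sum_congr rfl fun m hm => ?_
    have hm : m ∉ Set.range ι := (Finset.mem_filter.1 hm).2
    have hm' := hθ.mate_notMem_range hm
    have hne : ∀ k, ι k ≠ m := fun k hk => hm ⟨k, hk⟩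
    have hne' : ∀ k, ι k ≠ θ.mate m := fun k hk => hm' ⟨k, hk⟩
    simp_rw [hβ.mate_eq, hmate m hm]
    have hrest : (∑ x ∈ Finset.univ.filter (· ∉ Set.range ι),
          if m < x ∧ x ≤ θ.mate m ∧ m ≤ β.mate x then (1 : ℤ) else 0) =
        ∑ x ∈ Finset.univ.filter (· ∉ Set.range ι),
          if m < x ∧ x ≤ θ.mate m ∧ m ≤ θ.mate x then 1 else 0 :=
      Finset.sum_congr rfl fun x hx => by rw [hmate x (Finset.mem_filter.1 hx).2]
    have hflip : (∑ k, if m < ι k ∧ ι k < θ.mate m ∧ ι (α.mate k) < m then (1 : ℤ) else 0) =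
        ∑ k, if m < ι (α.mate k) ∧ ι (α.mate k) < θ.mate m ∧ ι k < m then 1 else 0 := by
      have hinv : Function.Involutive α.mate := α.mate_invol
      rw [← Equiv.sum_comp hinv.toPerm]
      simp only [Function.Involutive.coe_toPerm, α.mate_invol]
    have hright : (∑ k, if m < ι k ∧ ι k ≤ θ.mate m ∧ m ≤ ι (α.mate k) then (1 : ℤ) else 0) =
        (∑ k, if m < ι k ∧ ι k < θ.mate m then 1 else 0) -
        ∑ k, if m < ι k ∧ ι k < θ.mate m ∧ ι (α.mate k) < m then 1 else 0 := by
      rw [← Finset.sum_sub_distrib]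
      refine Finset.sum_congr rfl fun k _ => ?_
      have := hne' k
      grind
    have hleft : (∑ k, if ι k < m ∧ m ≤ ι (α.mate k) ∧ ι k ≤ θ.mate m then (1 : ℤ) else 0) =
        α.enclosing ι m (θ.mate m) +
        ∑ k, if m < ι (α.mate k) ∧ ι (α.mate k) < θ.mate m ∧ ι k < m then 1 else 0 := by
      rw [enclosing, ← Finset.sum_add_distrib]
      refine Finset.sum_congr rfl fun k _ => ?_
      have := hne' k
      have := hne (α.mate k)
      have := hne' (α.mate k)
      grind
    rw [hrest, hright, hleft, hflip]
    ring

theorem AgreeOutside.sum_le_sum {p q : ℕ} {c c' : Clan p q} {S : Finset (Fin (p + q))}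
    (h : AgreeOutside c c' S) (f : Fin (p + q) → Fin (p + q) → ℤ)
    (hS : ∑ k ∈ S, f k (c.mate k) ≤ ∑ k ∈ S, f k (c'.mate k)) :
    ∑ k, f k (c.mate k) ≤ ∑ k, f k (c'.mate k) := by
  rw [← Finset.sum_add_sum_compl S, ← Finset.sum_add_sum_compl S fun k => f k (c'.mate k)]
  refine add_le_add hS (Finset.sum_congr rfl fun k hk => ?_).le
  rw [(h k (by simpa using hk)).1]

theorem IsMatch.symm_eq {p q : ℕ} {c : Clan p q} {i j : Fin (p + q)} (h : c.IsMatch i j) :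
    c.mate j = i := by
  rw [← h.2, c.mate_invol]

theorem Transposition.enclosing_le {p q n : ℕ} {c c' : Clan p q} (h : Transposition c c')
    {ι : Fin (p + q) → Fin n} (hι : StrictMono ι) (a b : Fin n) :
    c.enclosing ι a b ≤ c'.enclosing ι a b := by
  unfold enclosing
  have two : ∀ {x y : Fin (p + q)}, AgreeOutside c c' {x, y} →
      AgreeOutside c c' ↑({x, y} : Finset (Fin (p + q))) := fun h => by simpa using h
  have three : ∀ {x y z : Fin (p + q)}, AgreeOutside c c' {x, y, z} →
      AgreeOutside c c' ↑({x, y, z} : Finset (Fin (p + q))) := fun h => by simpa using h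
  have four : ∀ {x y z w : Fin (p + q)}, AgreeOutside c c' {x, y, z, w} →
      AgreeOutside c c' ↑({x, y, z, w} : Finset (Fin (p + q))) := fun h => by simpa using h
  let f : Fin (p + q) → Fin (p + q) → ℤ := fun k l =>
    if ι k < a ∧ ι k < b ∧ a < ι l ∧ b < ι l then 1 else 0
  have f_nonneg : ∀ k l, 0 ≤ f k l := fun k l => by
    simp only [f]
    split_ifs <;> simp
  have f_zero : ∀ {k l}, l ≤ k → f k l = 0 := fun {k l} hkl => if_neg fun h =>
    absurd (h.1.trans h.2.2.1) (not_lt.2 (hι.monotone hkl))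
  have f_mono : ∀ {k l k' l'}, k' ≤ k → l ≤ l' → f k l ≤ f k' l' := fun {k l k' l'} hk hl => by
    have hk := hι.monotone hk
    have hl := hι.monotone hl
    simp only [f]
    split_ifs with h h'
    · exact le_rfl
    · exact absurd ⟨hk.trans_lt h.1, hk.trans_lt h.2.1, h.2.2.1.trans_le hl,
        h.2.2.2.trans_le hl⟩ h'
    · simp
    · exact le_rfl
  have f_disjoint : ∀ {x y z w}, x < y → y < z → z < w → f x y + f z w ≤ f x w :=
    fun {x y z w} hxy hyz hzw => by
      by_cases h : a < ι y
      · have : f z w = 0 := if_neg fun h' => lt_asymm h ((hι hyz).trans h'.1)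
        rw [this, add_zero]
        exact f_mono le_rfl (hyz.trans hzw).le
      · have : f x y = 0 := if_neg fun h' => h h'.2.2.1
        rw [this, zero_add]
        exact f_mono (hxy.trans hyz).le le_rfl
  have f_crossing : ∀ {x y z w}, x < y → z < w → f x z + f y w ≤ f x w + f y z :=
    fun {x y z w} hxy hzw => by
      have hxy := hι hxy
      have hzw := hι hzw
      clear * - hxy hzw
      simp only [f]
      grind
  have sum_two : ∀ {x y : Fin (p + q)} (g : Fin (p + q) → ℤ), x < y →
      ∑ k ∈ {x, y}, g k = g x + g y := fun g hxy => Finset.sum_pair hxy.ne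
  have sum_three : ∀ {x y z : Fin (p + q)} (g : Fin (p + q) → ℤ), x < y → y < z →
      ∑ k ∈ {x, y, z}, g k = g x + (g y + g z) := fun g hxy hyz => by
    rw [Finset.sum_insert (by simp [hxy.ne, (hxy.trans hyz).ne]), sum_two g hyz]
  have sum_four : ∀ {x y z w : Fin (p + q)} (g : Fin (p + q) → ℤ), x < y → y < z → z < w →
      ∑ k ∈ {x, y, z, w}, g k = g x + (g y + (g z + g w)) := fun g hxy hyz hzw => by
    rw [Finset.sum_insert (by
      simp [hxy.ne, (hxy.trans hyz).ne, (hxy.trans (hyz.trans hzw)).ne]), sum_three g hyz hzw]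
  rcases h with ⟨x, y, hxy, h1, h2, h3, ho⟩ | ⟨x, y, hxy, h1, h2, h3, ho⟩ |
    ⟨x, y, z, h1, hyz, h2, h3, h4, ho⟩ | ⟨x, y, z, h1, hyz, h2, h3, h4, ho⟩ |
    ⟨x, y, z, h1, hxy, h2, h3, h4, ho⟩ | ⟨x, y, z, h1, hxy, h2, h3, h4, ho⟩ |
    ⟨x, y, z, w, h1, hyz, h2, h3, h4, ho⟩ | ⟨x, y, z, w, h1, hyz, h2, h3, h4, h5, ho⟩ |
    ⟨x, y, z, w, h1, hyz, h2, h3, h4, h5, ho⟩ |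
    ⟨x, y, z, w, hxy, hyz, hzw, h1, h2, h3, h4, ho⟩
  · refine (two ho).sum_le_sum f ?_
    rw [sum_two _ hxy, sum_two _ hxy, h1.1, h2.1, h3.2, h3.symm_eq]
    linarith [f_zero (le_refl x), f_zero (le_refl y), f_zero hxy.le, f_nonneg x y]
  · refine (two ho).sum_le_sum f ?_
    rw [sum_two _ hxy, sum_two _ hxy, h1.1, h2.1, h3.2, h3.symm_eq]
    linarith [f_zero (le_refl x), f_zero (le_refl y), f_zero hxy.le, f_nonneg x y]
  · refine (three ho).sum_le_sum f ?_
    rw [sum_three _ h1.1 hyz, sum_three _ h1.1 hyz, h1.2, h1.symm_eq, h2.1, h3.2, h3.symm_eq, h4.1]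
    linarith [f_zero (le_refl x), f_zero (le_refl y), f_zero (le_refl z), f_zero h1.1.le, f_zero
      hyz.le, f_zero (h1.1.trans hyz).le, f_mono le_rfl hyz.le (k := x)]
  · refine (three ho).sum_le_sum f ?_
    rw [sum_three _ h1.1 hyz, sum_three _ h1.1 hyz, h1.2, h1.symm_eq, h2.1, h3.2, h3.symm_eq, h4.1]
    linarith [f_zero (le_refl x), f_zero (le_refl y), f_zero (le_refl z), f_zero h1.1.le, f_zero
      hyz.le, f_zero (h1.1.trans hyz).le, f_mono le_rfl hyz.le (k := x)]
  · refine (three ho).sum_le_sum f ?_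
    rw [sum_three _ hxy h2.1, sum_three _ hxy h2.1, h1.1, h2.2, h2.symm_eq, h3.2, h3.symm_eq, h4.1]
    linarith [f_zero (le_refl x), f_zero (le_refl y), f_zero (le_refl z), f_zero hxy.le, f_zero
      h2.1.le, f_zero (hxy.trans h2.1).le, f_mono hxy.le le_rfl (l := z)]
  · refine (three ho).sum_le_sum f ?_
    rw [sum_three _ hxy h2.1, sum_three _ hxy h2.1, h1.1, h2.2, h2.symm_eq, h3.2, h3.symm_eq, h4.1]
    linarith [f_zero (le_refl x), f_zero (le_refl y), f_zero (le_refl z), f_zero hxy.le, f_zero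
      h2.1.le, f_zero (hxy.trans h2.1).le, f_mono hxy.le le_rfl (l := z)]
  · refine (four ho).sum_le_sum f ?_
    rw [sum_four _ h1.1 hyz h2.1, sum_four _ h1.1 hyz h2.1, h1.2, h1.symm_eq, h2.2, h2.symm_eq,
      h3.2, h3.symm_eq, h4.2, h4.symm_eq]
    linarith [f_zero (le_refl x), f_zero (le_refl y), f_zero (le_refl z), f_zero (le_refl w), f_zero
      h1.1.le, f_zero hyz.le, f_zero h2.1.le, f_zero (h1.1.trans hyz).le, f_zero (hyz.trans
      h2.1).le, f_zero (h1.1.trans (hyz.trans h2.1)).le, f_mono le_rfl hyz.le (k := x), f_mono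
      hyz.le le_rfl (l := w)]
  · refine (four ho).sum_le_sum f ?_
    rw [sum_four _ h1.1 hyz h2.1, sum_four _ h1.1 hyz h2.1, h1.2, h1.symm_eq, h2.2, h2.symm_eq,
      h3.2, h3.symm_eq, h4.1, h5.1]
    linarith [f_zero (le_refl x), f_zero (le_refl y), f_zero (le_refl z), f_zero (le_refl w), f_zero
      h1.1.le, f_zero hyz.le, f_zero h2.1.le, f_zero (h1.1.trans hyz).le, f_zero (hyz.trans
      h2.1).le, f_zero (h1.1.trans (hyz.trans h2.1)).le, f_disjoint h1.1 hyz h2.1]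
  · refine (four ho).sum_le_sum f ?_
    rw [sum_four _ h1.1 hyz h2.1, sum_four _ h1.1 hyz h2.1, h1.2, h1.symm_eq, h2.2, h2.symm_eq,
      h3.2, h3.symm_eq, h4.1, h5.1]
    linarith [f_zero (le_refl x), f_zero (le_refl y), f_zero (le_refl z), f_zero (le_refl w), f_zero
      h1.1.le, f_zero hyz.le, f_zero h2.1.le, f_zero (h1.1.trans hyz).le, f_zero (hyz.trans
      h2.1).le, f_zero (h1.1.trans (hyz.trans h2.1)).le, f_disjoint h1.1 hyz h2.1]
  · refine (four ho).sum_le_sum f ?_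
    rw [sum_four _ hxy hyz hzw, sum_four _ hxy hyz hzw, h1.2, h1.symm_eq, h2.2, h2.symm_eq,
      h3.2, h3.symm_eq, h4.2, h4.symm_eq]
    linarith [f_zero (le_refl x), f_zero (le_refl y), f_zero (le_refl z), f_zero (le_refl w), f_zero
      hxy.le, f_zero hyz.le, f_zero hzw.le, f_zero (hxy.trans hyz).le, f_zero (hyz.trans hzw).le,
      f_zero (hxy.trans (hyz.trans hzw)).le, f_crossing hxy hzw]

theorem ble.enclosing_le {p q n : ℕ} {c c' : Clan p q} (h : ble c c')
    {ι : Fin (p + q) → Fin n} (hι : StrictMono ι) (a b : Fin n) :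
    c.enclosing ι a b ≤ c'.enclosing ι a b := by
  induction h with
  | refl => exact le_rfl
  | tail _ ht ih => exact ih.trans (ht.enclosing_le hι a b)

/-- The difference `ℓ(Φ(α)) - ℓ(α)` is monotone in `α` for the Bruhat order. -/
theorem ble.len_sub_le {p q r s : ℕ} {α α' γ : Clan p q} {β β' θ : Clan r s}
    {ι : Fin (p + q) → Fin (r + s)} (h : ble α α') (hθ : Pattern θ γ ι)
    (hβ : Pattern β α ι) (hβ' : Pattern β' α' ι) (hout : AgreesWithOutside β θ ι)
    (hout' : AgreesWithOutside β' θ ι) : β.len - α.len ≤ β'.len - α'.len := by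
  rw [len_eq_of_agreesWithOutside hθ hβ hout, len_eq_of_agreesWithOutside hθ hβ' hout',
    add_sub_cancel_left, add_sub_cancel_left]
  exact Finset.sum_le_sum fun m _ => add_le_add le_rfl (h.enclosing_le hβ.1 _ _)

/-- The clan `Φ(α)` exists: a pattern occurrence of `γ` in `θ` can be replaced by any clan of
the same signature. -/
theorem Pattern.exists_replace {p q r s : ℕ} {θ : Clan r s} {γ : Clan p q}
    {ι : Fin (p + q) → Fin (r + s)} (h : Pattern θ γ ι) (α : Clan p q) :
    ∃ β : Clan r s, Pattern β α ι ∧ AgreesWithOutside β θ ι := by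
  have hinj := h.1.injective
  let μ : Fin (r + s) → Fin (r + s) := fun m =>
    if hm : ∃ k, ι k = m then ι (α.mate hm.choose) else θ.mate m
  let σ : Fin (r + s) → Bool := fun m =>
    if hm : ∃ k, ι k = m then α.sign hm.choose else θ.sign m
  have hchoose : ∀ k (hk : ∃ k', ι k' = ι k), hk.choose = k := fun k hk => hinj hk.choose_spec
  have μ_in : ∀ k, μ (ι k) = ι (α.mate k) := fun k => by
    have hk : ∃ k', ι k' = ι k := ⟨k, rfl⟩
    simp only [μ, dif_pos hk, hchoose]
  have σ_in : ∀ k, σ (ι k) = α.sign k := fun k => by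
    have hk : ∃ k', ι k' = ι k := ⟨k, rfl⟩
    simp only [σ, dif_pos hk, hchoose]
  have μ_out : ∀ m, m ∉ Set.range ι → μ m = θ.mate m := fun m hm => dif_neg hm
  have σ_out : ∀ m, m ∉ Set.range ι → σ m = θ.sign m := fun m hm => dif_neg hm
  have hcard : ∀ b : Bool,
      (Finset.univ.filter fun m => μ m = m ∧ σ m = b).card +
        (Finset.univ.filter fun k => γ.mate k = k ∧ γ.sign k = b).card =
      (Finset.univ.filter fun m => θ.mate m = m ∧ θ.sign m = b).card +
        (Finset.univ.filter fun k => α.mate k = k ∧ α.sign k = b).card := by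
    intro b
    simp only [Finset.card_filter]
    rw [Fintype.sum_eq_sum_range_add hinj, Fintype.sum_eq_sum_range_add hinj
      fun m => if θ.mate m = m ∧ θ.sign m = b then 1 else 0]
    simp_rw [μ_in, σ_in, h.mate_eq, h.sign_eq, hinj.eq_iff]
    have hrest : (∑ m ∈ Finset.univ.filter (· ∉ Set.range ι),
          if μ m = m ∧ σ m = b then 1 else 0) =
        ∑ m ∈ Finset.univ.filter (· ∉ Set.range ι),
          if θ.mate m = m ∧ θ.sign m = b then 1 else 0 :=
      Finset.sum_congr rfl fun m hm => by
        rw [μ_out m (Finset.mem_filter.1 hm).2, σ_out m (Finset.mem_filter.1 hm).2]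
    rw [hrest]
    ring
  refine ⟨⟨μ, fun m => ?_, σ, fun m hm => ?_, ?_⟩, ⟨h.1, fun k hk => ?_, fun k l hkl => ?_⟩,
    fun m hm => ?_⟩
  · by_cases hm : m ∈ Set.range ι
    · obtain ⟨k, rfl⟩ := hm
      rw [μ_in, μ_in, α.mate_invol]
    · rw [μ_out m hm, μ_out _ (h.mate_notMem_range hm), θ.mate_invol]
  · by_cases hm' : m ∈ Set.range ι
    · obtain ⟨k, rfl⟩ := hm'
      rw [μ_in, hinj.ne_iff] at hm
      rw [σ_in, α.sign_matched k hm]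
    · rw [μ_out m hm'] at hm
      rw [σ_out m hm', θ.sign_matched m hm]
  · have := hcard true
    have := hcard false
    have := α.plus_minus
    have := γ.plus_minus
    have := θ.plus_minus
    omega
  · exact ⟨(μ_in k).trans (congrArg ι hk), σ_in k⟩
  · exact ⟨h.1 hkl.1, (μ_in k).trans (congrArg ι hkl.2)⟩
  · have hm' : m ∉ Set.range ι := fun ⟨k, hk⟩ => hm k hk
    exact ⟨μ_out m hm', σ_out m hm'⟩

end Clan

/-- if `α ≤ α' ≤ γ` and `θ` avoids the interval `[α',γ]`,
then `θ` avoids the interval `[α,γ]`. -/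
theorem interval_avoidance_down {p q r s : ℕ} (α α' γ : Clan p q) (θ : Clan r s)
    (h1 : Clan.ble α α') (h2 : Clan.ble α' γ)
    (hav : ¬ Clan.IntervalContains θ α' γ) :
    ¬ Clan.IntervalContains θ α γ := by
  rintro ⟨ι, β, hθ, hβ, hout, hlen⟩
  obtain ⟨β', hβ', hout'⟩ := hθ.exists_replace α'
  refine hav ⟨ι, β', hθ, hβ', hout', ?_⟩
  have hle := h1.len_sub_le hθ hβ hβ' hout hout'
  have hle' := h2.len_sub_le hθ hβ' hθ hout' fun _ _ => ⟨rfl, rfl⟩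
  omega
end
end

section
/- Suppose [α,γ] interval pattern embeds into [β,θ] via index set I, and let J be the complement of I. If j ∈ J and β_j (equivalently θ_j, since β and θ agree outside I) is a sign, then β(j;+) = θ(j;+) and β(j;−) = θ(j;−). -/
noncomputable section
open scoped Classical

namespace Clan

variable {p q r s : ℕ}

/-- Reindexing a sum over all positions by the matching involution. -/
lemma sum_mate (c : Clan p q) (f : Fin (p + q) → ℤ) : ∑ x, f (c.mate x) = ∑ x, f x :=
  Equiv.sum_comp (Function.Involutive.toPerm c.mate c.mate_invol) f

/-- A sum over matchings as a sum over left endpoints. -/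
lemma sum_match (c : Clan p q) (g : Fin (p + q) → Fin (p + q) → ℤ) :
    ∑ ab ∈ Finset.univ.filter (fun ab : Fin (p + q) × Fin (p + q) => c.IsMatch ab.1 ab.2),
      g ab.1 ab.2 = ∑ x, if x < c.mate x then g x (c.mate x) else 0 := by
  rw [Finset.sum_filter, Fintype.sum_prod_type]
  refine Finset.sum_congr rfl fun x _ => ?_
  rw [Finset.sum_eq_single (c.mate x)]
  · simp [IsMatch]
  · intro y _ hy
    rw [if_neg]
    rintro ⟨_, h⟩
    exact hy h.symm
  · simp

/-- Counting matchings with a property by their left endpoints. -/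
lemma card_match (c : Clan p q) (P : Fin (p + q) → Fin (p + q) → Prop) :
    ((Finset.univ.filter (fun ab : Fin (p + q) × Fin (p + q) =>
      c.IsMatch ab.1 ab.2 ∧ P ab.1 ab.2)).card : ℤ) =
      ∑ x, if x < c.mate x ∧ P x (c.mate x) then 1 else 0 := by
  rw [← Finset.filter_filter, Finset.card_filter]
  push_cast
  rw [sum_match c (fun a b => if P a b then 1 else 0)]
  refine Finset.sum_congr rfl fun x _ => ?_
  split_ifs <;> tauto

/-- The contribution of an ordered pair of positions to the length of a clan with matching
involution `m`. -/
def lenTerm {n : ℕ} (m : Fin n → Fin n) (x y : Fin n) : ℤ :=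
  (if x < y ∧ y ≤ m x then 1 else 0) - (if y < x ∧ x < m y ∧ m y < m x then 1 else 0)

lemma len_eq_sum_s7 (c : Clan p q) : c.len = ∑ x, ∑ y, lenTerm c.mate x y := by
  unfold len
  rw [sum_match c (fun a b => ((b : ℕ) : ℤ) - ((a : ℕ) : ℤ) -
      ((Finset.univ.filter (fun st : Fin (p + q) × Fin (p + q) =>
          c.IsMatch st.1 st.2 ∧ st.1 < a ∧ a < st.2 ∧ st.2 < b)).card : ℤ))]
  refine Finset.sum_congr rfl fun x _ => ?_
  simp only [lenTerm, Finset.sum_sub_distrib]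
  split_ifs with h
  · congr 1
    · rw [← Finset.sum_filter, Finset.sum_const]
      have : (Finset.univ.filter fun y => x < y ∧ y ≤ c.mate x) = Finset.Ioc x (c.mate x) := by
        ext y
        simp
      rw [this, Fin.card_Ioc]
      have := Fin.lt_def.1 h
      simp
      omega
    · refine Eq.trans ?_ ((card_match c (fun a b => a < x ∧ x < b ∧ b < c.mate x)).trans ?_)
      · congr!
      refine Finset.sum_congr rfl fun y _ => ?_
      congr 1
      apply propext
      constructor
      · tauto
      · intro h
        exact ⟨h.1.trans h.2.1, h⟩
  · rw [Finset.sum_eq_zero, Finset.sum_eq_zero]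
    · simp
    · intro y _
      rw [if_neg]
      rintro ⟨h1, h2, h3⟩
      exact h (h2.trans h3)
    · intro y _
      rw [if_neg]
      rintro ⟨h1, h2⟩
      exact h (h1.trans_le h2)

/-- The number of matchings whose left endpoint lies in `S` to the left of `a` and whose right
endpoint lies to the right of `b`. -/
def cover (c : Clan p q) (S : Set (Fin (p + q))) (a b : Fin (p + q)) : ℤ :=
  ∑ x, if x ∈ S ∧ x < a ∧ b < c.mate x then 1 else 0

/-- The number of signs `ε` plus the number of matchings among the positions up to `j`. -/
def signStat (c : Clan p q) (ε : Bool) (j : Fin (p + q)) : ℤ :=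
  ∑ x, ((if x ≤ j ∧ c.mate x = x ∧ c.sign x = ε then 1 else 0) +
    (if x < c.mate x ∧ c.mate x ≤ j then 1 else 0))

lemma statPlus_eq (c : Clan p q) (j : Fin (p + q)) :
    (c.statPlus ((j : ℕ) + 1) : ℤ) = c.signStat true j := by
  unfold statPlus signStat
  have h := card_match c (fun _ b => (b : ℕ) < j + 1)
  simp only [Nat.lt_succ_iff, ← Fin.le_def] at h ⊢
  rw [Finset.sum_add_distrib, ← Finset.natCast_card_filter, Nat.cast_add]
  exact congrArg₂ (· + ·) (by congr!) (by convert h)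

lemma statMinus_eq (c : Clan p q) (j : Fin (p + q)) :
    (c.statMinus ((j : ℕ) + 1) : ℤ) = c.signStat false j := by
  unfold statMinus signStat
  have h := card_match c (fun _ b => (b : ℕ) < j + 1)
  simp only [Nat.lt_succ_iff, ← Fin.le_def] at h ⊢
  rw [Finset.sum_add_distrib, ← Finset.natCast_card_filter, Nat.cast_add]
  exact congrArg₂ (· + ·) (by congr!) (by convert h)

lemma signStat_add_cover (c : Clan p q) (j : Fin (p + q)) (hj : c.mate j = j) :
    c.signStat true j + c.signStat false j + c.cover Set.univ j j =
      ∑ x, if x ≤ j then 1 else 0 := by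
  have h := c.sum_mate fun x => if x < c.mate x ∧ c.mate x ≤ j then 1 else 0
  simp only [c.mate_invol] at h
  have h' : ∑ x, ((if x ≤ j ∧ c.mate x = x ∧ c.sign x = true then (1 : ℤ) else 0) +
      (if x ≤ j ∧ c.mate x = x ∧ c.sign x = false then 1 else 0) +
      (if x < c.mate x ∧ c.mate x ≤ j then 1 else 0) +
      (if c.mate x < x ∧ x ≤ j then 1 else 0) +
      (if x < j ∧ j < c.mate x then 1 else 0)) =
      ∑ x, if x ≤ j then 1 else 0 := by
    refine Finset.sum_congr rfl fun x _ => ?_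
    have hx : x = j → c.mate x = j := fun h => by rw [h, hj]
    cases c.sign x <;> simp <;> grind
  simp only [Finset.sum_add_distrib] at h'
  rw [h] at h'
  rw [← h']
  simp only [signStat, cover, Set.mem_univ, true_and, Finset.sum_add_distrib]
  ring

/-- A statistic that is a sum of local terms is compared on the positions that change. -/
lemma sum_le_of_agree {c c' : Clan p q} {T : Finset (Fin (p + q))}
    (h : AgreeOutside c c' (T : Set (Fin (p + q))))
    (F : Fin (p + q) → Fin (p + q) → Bool → ℤ)
    (hF : ∑ x ∈ T, F x (c.mate x) (c.sign x) ≤ ∑ x ∈ T, F x (c'.mate x) (c'.sign x)) :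
    ∑ x, F x (c.mate x) (c.sign x) ≤ ∑ x, F x (c'.mate x) (c'.sign x) := by
  rw [← Finset.sum_add_sum_compl T, ← Finset.sum_add_sum_compl T]
  refine add_le_add hF (le_of_eq (Finset.sum_congr rfl fun x hx => ?_))
  obtain ⟨h1, h2⟩ := h x (by simpa using hx)
  rw [h1, h2]

lemma IsMatch.symm {c : Clan p q} {a b : Fin (p + q)} (h : c.IsMatch a b) : c.mate b = a := by
  rw [← h.2, c.mate_invol]

/-- A local statistic is monotone along a transposition if it is so on the symbols of each of
the ten patterns. -/
lemma Transposition.sum_le {c c' : Clan p q} (h : Transposition c c')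
    (F : Fin (p + q) → Fin (p + q) → Bool → ℤ)
    (hF : ∀ x y e, x ≠ y → F x y e = F x y true)
    (h1 : ∀ a b e, a < b → F a a e + F b b (!e) ≤ F a b true + F b a true)
    (h3 : ∀ a b d e, a < b → b < d →
      F a b true + F b a true + F d d e ≤ F a d true + F d a true + F b b e)
    (h5 : ∀ a b d e, a < b → b < d →
      F a a e + F b d true + F d b true ≤ F a d true + F d a true + F b b e)
    (h7 : ∀ i j k l, i < j → j < k → k < l →
      F i j true + F j i true + F k l true + F l k true ≤
        F i k true + F k i true + F j l true + F l j true)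
    (h8 : ∀ i j k l e, i < j → j < k → k < l →
      F i j true + F j i true + F k l true + F l k true ≤
        F i l true + F l i true + F j j e + F k k (!e))
    (h10 : ∀ i j k l, i < j → j < k → k < l →
      F i k true + F k i true + F j l true + F l j true ≤
        F i l true + F l i true + F j k true + F k j true) :
    ∑ x, F x (c.mate x) (c.sign x) ≤ ∑ x, F x (c'.mate x) (c'.sign x) := by
  have hm : ∀ (d : Clan p q) {x y : Fin (p + q)}, d.IsMatch x y →
      F x (d.mate x) (d.sign x) = F x y true ∧ F y (d.mate y) (d.sign y) = F y x true :=
    fun d x y h => by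
      rw [h.symm, h.2]
      exact ⟨hF _ _ _ h.1.ne, hF _ _ _ h.1.ne'⟩
  have hs : ∀ (d : Clan p q) {x : Fin (p + q)} {e : Bool}, d.mate x = x ∧ d.sign x = e →
      F x (d.mate x) (d.sign x) = F x x e :=
    fun d x e h => by rw [h.1, h.2]
  have key1 : ∀ a b e, a < b → (c.mate a = a ∧ c.sign a = e) →
      (c.mate b = b ∧ c.sign b = !e) → c'.IsMatch a b → AgreeOutside c c' {a, b} →
      ∑ x, F x (c.mate x) (c.sign x) ≤ ∑ x, F x (c'.mate x) (c'.sign x) := by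
    intro a b e hab ha hb hab' hag
    refine sum_le_of_agree (T := {a, b}) (by simpa using hag) F ?_
    rw [Finset.sum_pair hab.ne, Finset.sum_pair hab.ne]
    linarith [h1 a b e hab, hs c ha, hs c hb, hm c' hab']
  have sum3 : ∀ {a b d : Fin (p + q)} (g : Fin (p + q) → ℤ), a < b → b < d →
      ∑ x ∈ ({a, b, d} : Finset (Fin (p + q))), g x = g a + g b + g d := by
    intro a b d g hab hbd
    rw [Finset.sum_insert (by simp [hab.ne, (hab.trans hbd).ne]), Finset.sum_pair hbd.ne, add_assoc]
  have sum4 : ∀ {i j k l : Fin (p + q)} (g : Fin (p + q) → ℤ), i < j → j < k → k < l →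
      ∑ x ∈ ({i, j, k, l} : Finset (Fin (p + q))), g x = g i + g j + g k + g l := by
    intro i j k l g hij hjk hkl
    rw [Finset.sum_insert (by simp [hij.ne, (hij.trans hjk).ne, (hij.trans (hjk.trans hkl)).ne]),
      sum3 g hjk hkl]
    ring
  have key3 : ∀ a b d e, c.IsMatch a b → b < d → (c.mate d = d ∧ c.sign d = e) →
      c'.IsMatch a d → (c'.mate b = b ∧ c'.sign b = e) → AgreeOutside c c' {a, b, d} →
      ∑ x, F x (c.mate x) (c.sign x) ≤ ∑ x, F x (c'.mate x) (c'.sign x) := by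
    intro a b d e hab hbd hd had hb hag
    refine sum_le_of_agree (T := {a, b, d}) (by simpa using hag) F ?_
    rw [sum3 _ hab.1 hbd, sum3 _ hab.1 hbd]
    linarith [h3 a b d e hab.1 hbd, hm c hab, hs c hd, hm c' had, hs c' hb]
  have key5 : ∀ a b d e, (c.mate a = a ∧ c.sign a = e) → a < b → c.IsMatch b d →
      c'.IsMatch a d → (c'.mate b = b ∧ c'.sign b = e) → AgreeOutside c c' {a, b, d} →
      ∑ x, F x (c.mate x) (c.sign x) ≤ ∑ x, F x (c'.mate x) (c'.sign x) := by
    intro a b d e ha hab hbd had hb hag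
    refine sum_le_of_agree (T := {a, b, d}) (by simpa using hag) F ?_
    rw [sum3 _ hab hbd.1, sum3 _ hab hbd.1]
    linarith [h5 a b d e hab hbd.1, hm c hbd, hs c ha, hm c' had, hs c' hb]
  have key8 : ∀ i j k l e, c.IsMatch i j → j < k → c.IsMatch k l → c'.IsMatch i l →
      (c'.mate j = j ∧ c'.sign j = e) → (c'.mate k = k ∧ c'.sign k = !e) →
      AgreeOutside c c' {i, j, k, l} →
      ∑ x, F x (c.mate x) (c.sign x) ≤ ∑ x, F x (c'.mate x) (c'.sign x) := by
    intro i j k l e hij hjk hkl hil hj hk hag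
    refine sum_le_of_agree (T := {i, j, k, l}) (by simpa using hag) F ?_
    rw [sum4 _ hij.1 hjk hkl.1, sum4 _ hij.1 hjk hkl.1]
    linarith [h8 i j k l e hij.1 hjk hkl.1, hm c hij, hm c hkl, hm c' hil, hs c' hj, hs c' hk]
  rcases h with ⟨a, b, hab, ha, hb, hab', hag⟩ | ⟨a, b, hab, ha, hb, hab', hag⟩ |
    ⟨a, b, d, hab, hbd, hd, had, hb, hag⟩ | ⟨a, b, d, hab, hbd, hd, had, hb, hag⟩ |
    ⟨a, b, d, ha, hab, hbd, had, hb, hag⟩ | ⟨a, b, d, ha, hab, hbd, had, hb, hag⟩ |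
    ⟨i, j, k, l, hij, hjk, hkl, hik, hjl, hag⟩ | ⟨i, j, k, l, hij, hjk, hkl, hil, hj, hk, hag⟩ |
    ⟨i, j, k, l, hij, hjk, hkl, hil, hj, hk, hag⟩ |
    ⟨i, j, k, l, hij, hjk, hkl, hik, hjl, hil, hjk', hag⟩
  · exact key1 a b true hab ha hb hab' hag
  · exact key1 a b false hab ha hb hab' hag
  · exact key3 a b d true hab hbd hd had hb hag
  · exact key3 a b d false hab hbd hd had hb hag
  · exact key5 a b d true ha hab hbd had hb hag
  · exact key5 a b d false ha hab hbd had hb hag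
  · refine sum_le_of_agree (T := {i, j, k, l}) (by simpa using hag) F ?_
    rw [sum4 _ hij.1 hjk hkl.1, sum4 _ hij.1 hjk hkl.1]
    linarith [h7 i j k l hij.1 hjk hkl.1, hm c hij, hm c hkl, hm c' hik, hm c' hjl]
  · exact key8 i j k l true hij hjk hkl hil hj hk hag
  · exact key8 i j k l false hij hjk hkl hil hj hk hag
  · refine sum_le_of_agree (T := {i, j, k, l}) (by simpa using hag) F ?_
    rw [sum4 _ hij hjk hkl, sum4 _ hij hjk hkl]
    linarith [h10 i j k l hij hjk hkl, hm c hik, hm c hjl, hm c' hil, hm c' hjk']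

lemma cover_mono_of_transposition {c c' : Clan p q} (h : Transposition c c')
    {a b : Fin (p + q)} (hab : a ≤ b) : c.cover Set.univ a b ≤ c'.cover Set.univ a b := by
  have := h.sum_le (fun x y _ => if x < a ∧ b < y then 1 else 0) (by grind) (by grind)
    (by grind) (by grind) (by grind) (by grind) (by grind)
  simpa only [cover, Set.mem_univ, true_and] using this

lemma signStat_anti_of_transposition {c c' : Clan p q} (h : Transposition c c')
    (ε : Bool) (j : Fin (p + q)) : c'.signStat ε j ≤ c.signStat ε j := by
  have := h.sum_le (fun x y e => -((if x ≤ j ∧ y = x ∧ e = ε then 1 else 0) +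
    (if x < y ∧ y ≤ j then 1 else 0))) ?_ ?_ ?_ ?_ ?_ ?_ ?_
  · simp only [Finset.sum_neg_distrib] at this
    exact neg_le_neg_iff.1 this
  · grind
  · rintro a b (_ | _) hab <;> cases ε <;> grind
  · grind
  · grind
  · grind
  · rintro i j k l (_ | _) hij hjk hkl <;> cases ε <;> grind
  · grind

lemma cover_mono {c c' : Clan p q} (h : ble c c') {a b : Fin (p + q)} (hab : a ≤ b) :
    c.cover Set.univ a b ≤ c'.cover Set.univ a b := by
  induction h with
  | refl => rfl
  | tail _ h ih => exact ih.trans (cover_mono_of_transposition h hab)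

lemma signStat_anti {c c' : Clan p q} (h : ble c c') (ε : Bool) (j : Fin (p + q)) :
    c'.signStat ε j ≤ c.signStat ε j := by
  induction h with
  | refl => rfl
  | tail _ h ih => exact (signStat_anti_of_transposition h ε j).trans ih

lemma cover_univ (c : Clan p q) (S : Set (Fin (p + q))) (a b : Fin (p + q)) :
    c.cover Set.univ a b = c.cover S a b + c.cover Sᶜ a b := by
  unfold cover
  rw [← Finset.sum_add_distrib]
  refine Finset.sum_congr rfl fun x _ => ?_
  by_cases h : x ∈ S <;> simp [h]

/-- The four ordered pairs formed by a position `x` and the two ends `y`, `m y` of a matching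
(or twice a sign) contribute a term that is fixed plus the covering indicator. -/
lemma lenTerm_cross {n : ℕ} (m : Fin n → Fin n) {x y : Fin n} (hy : m (m y) = y)
    (h1 : x ≠ y) (h2 : x ≠ m y) (h3 : m x ≠ y) (h4 : m x ≠ m y) :
    lenTerm m x y + lenTerm m y x + (lenTerm m x (m y) + lenTerm m (m y) x) =
      (if min y (m y) < x ∧ x < max y (m y) then 1 else 0) +
        2 * (if x < min y (m y) ∧ max y (m y) < m x then 1 else 0) := by
  unfold lenTerm
  rw [hy]
  generalize m y = z at *
  generalize m x = w at *
  rcases le_total y z with h | h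
  · rw [min_eq_left h, max_eq_right h]
    rcases h1.lt_or_gt with h1 | h1 <;> rcases h2.lt_or_gt with h2 | h2 <;>
      rcases h3.lt_or_gt with h3 | h3 <;> rcases h4.lt_or_gt with h4 | h4 <;> grind
  · rw [min_eq_right h, max_eq_left h]
    rcases h1.lt_or_gt with h1 | h1 <;> rcases h2.lt_or_gt with h2 | h2 <;>
      rcases h3.lt_or_gt with h3 | h3 <;> rcases h4.lt_or_gt with h4 | h4 <;> grind

/-- The length of a clan, split along a union `S` of matchings and signs. -/
lemma two_len_split (c : Clan p q) (S : Set (Fin (p + q))) (hS : ∀ x, c.mate x ∈ S ↔ x ∈ S) :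
    2 * c.len = 2 * (∑ x, ∑ y, if x ∈ S ∧ y ∈ S then lenTerm c.mate x y else 0) +
      2 * (∑ x, ∑ y, if x ∉ S ∧ y ∉ S then lenTerm c.mate x y else 0) +
      ∑ y, if y ∉ S then (∑ x, if x ∈ S ∧ min y (c.mate y) < x ∧ x < max y (c.mate y)
        then 1 else 0) + 2 * c.cover S (min y (c.mate y)) (max y (c.mate y)) else 0 := by
  set g : Fin (p + q) → ℤ := fun y =>
    if y ∉ S then ∑ x, if x ∈ S then lenTerm c.mate x y + lenTerm c.mate y x else 0 else 0
  have hlen : c.len = (∑ x, ∑ y, if x ∈ S ∧ y ∈ S then lenTerm c.mate x y else 0) +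
      (∑ x, ∑ y, if x ∉ S ∧ y ∉ S then lenTerm c.mate x y else 0) + ∑ y, g y := by
    have hg : ∑ y, g y = (∑ x, ∑ y, if x ∈ S ∧ y ∉ S then lenTerm c.mate x y else 0) +
        ∑ x, ∑ y, if x ∉ S ∧ y ∈ S then lenTerm c.mate x y else 0 := by
      rw [Finset.sum_comm (f := fun x y => if x ∈ S ∧ y ∉ S then lenTerm c.mate x y else 0),
        ← Finset.sum_add_distrib]
      refine Finset.sum_congr rfl fun y _ => ?_
      rw [← Finset.sum_add_distrib]
      by_cases hy : y ∈ S
      · simp [g, hy]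
      · simp only [g, hy, not_false_eq_true, if_true, and_true, true_and]
        refine Finset.sum_congr rfl fun x _ => ?_
        by_cases hx : x ∈ S <;> simp [hx]
    rw [len_eq_sum_s7, hg]
    simp only [← Finset.sum_add_distrib]
    refine Finset.sum_congr rfl fun x _ => Finset.sum_congr rfl fun y _ => ?_
    by_cases hx : x ∈ S <;> by_cases hy : y ∈ S <;> simp [hx, hy]
  have hgg : 2 * ∑ y, g y = ∑ y, (g y + g (c.mate y)) := by
    rw [Finset.sum_add_distrib, c.sum_mate g, two_mul]
  rw [hlen, mul_add, mul_add, hgg]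
  congr 1
  refine Finset.sum_congr rfl fun y _ => ?_
  by_cases hy : y ∈ S
  · simp [g, hy, hS]
  · simp only [g, hS, hy, not_false_eq_true, if_true, cover]
    rw [Finset.mul_sum, ← Finset.sum_add_distrib, ← Finset.sum_add_distrib]
    refine Finset.sum_congr rfl fun x _ => ?_
    by_cases hx : x ∈ S
    · simp only [hx, if_true, true_and]
      refine lenTerm_cross c.mate (c.mate_invol y) ?_ ?_ ?_ ?_
      · rintro rfl
        exact hy hx
      · rintro rfl
        exact hy ((hS y).1 hx)
      · rintro rfl
        exact hy ((hS x).2 hx)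
      · intro h
        exact hy ((hS y).1 (h ▸ (hS x).2 hx))
    · simp [hx]

lemma Pattern.mate_mem_range {θ : Clan r s} {γ : Clan p q} {ι : Fin (p + q) → Fin (r + s)}
    (h : Pattern θ γ ι) (x : Fin (r + s)) : θ.mate x ∈ Set.range ι ↔ x ∈ Set.range ι := by
  have key : ∀ x, x ∈ Set.range ι → θ.mate x ∈ Set.range ι := by
    rintro _ ⟨k, rfl⟩
    exact ⟨_, (h.mate_apply k).symm⟩
  refine ⟨fun hx => ?_, key x⟩
  rw [← θ.mate_invol x]
  exact key _ hx

lemma sum_range {n m : ℕ} {ι : Fin m → Fin n} (hι : Function.Injective ι) {S : Set (Fin n)}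
    (hS : S = Set.range ι) (f : Fin n → ℤ) :
    ∑ x, (if x ∈ S then f x else 0) = ∑ k, f (ι k) := by
  rw [← Finset.sum_filter, ← Finset.sum_image (g := ι) (s := Finset.univ) (f := f)
    (fun a _ b _ h => hι h)]
  congr 1
  ext x
  simp [hS]

/-- The positions of an embedded pattern contribute the length of the pattern. -/
lemma Pattern.sum_lenTerm {θ : Clan r s} {γ : Clan p q} {ι : Fin (p + q) → Fin (r + s)}
    (h : Pattern θ γ ι) {S : Set (Fin (r + s))} (hS : S = Set.range ι) :
    (∑ x, ∑ y, if x ∈ S ∧ y ∈ S then lenTerm θ.mate x y else 0) = γ.len := by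
  have hι := h.1.injective
  have h1 : ∀ x, (∑ y, if x ∈ S ∧ y ∈ S then lenTerm θ.mate x y else 0) =
      if x ∈ S then ∑ l, lenTerm θ.mate x (ι l) else 0 := by
    intro x
    rw [← sum_range hι hS (fun y => lenTerm θ.mate x y)]
    by_cases hx : x ∈ S <;> simp [hx]
  simp only [h1]
  rw [sum_range hι hS (fun x => ∑ l, lenTerm θ.mate x (ι l)), len_eq_sum_s7]
  refine Finset.sum_congr rfl fun k _ => Finset.sum_congr rfl fun l _ => ?_
  simp only [lenTerm, h.mate_apply, h.1.lt_iff_lt, h.1.le_iff_le]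

/-- In an interval pattern embedding, every matching or sign outside the image is covered by the
same number of matchings in both clans. -/
lemma IntervalEmbed.cover_eq {α γ : Clan p q} {β θ : Clan r s} {ι : Fin (p + q) → Fin (r + s)}
    (hemb : IntervalEmbed α γ β θ ι) (hβθ : ble β θ) {y : Fin (r + s)} (hy : y ∉ Set.range ι) :
    β.cover Set.univ (min y (β.mate y)) (max y (β.mate y)) =
      θ.cover Set.univ (min y (β.mate y)) (max y (β.mate y)) := by
  obtain ⟨hθ, hβ, hag, hlen⟩ := hemb
  obtain ⟨S, hS⟩ : ∃ S, S = Set.range ι := ⟨_, rfl⟩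
  rw [← hS] at hy
  have hm : ∀ x, x ∉ S → θ.mate x = β.mate x := fun x hx =>
    (hag x fun k hk => hx (hS ▸ ⟨k, hk⟩)).1.symm
  have hcompl : ∀ a b, β.cover Sᶜ a b = θ.cover Sᶜ a b := fun a b => by
    refine Finset.sum_congr rfl fun x _ => ?_
    by_cases hx : x ∈ S
    · simp [hx]
    · rw [hm x hx]
  have hmono : ∀ z, β.cover S (min z (β.mate z)) (max z (β.mate z)) ≤
      θ.cover S (min z (β.mate z)) (max z (β.mate z)) := fun z => by
    have := cover_mono hβθ (a := min z (β.mate z)) (b := max z (β.mate z)) min_le_max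
    rw [cover_univ β S, cover_univ θ S, hcompl] at this
    linarith
  have hβlen := two_len_split β S (hS ▸ hβ.mate_mem_range)
  have hθlen := two_len_split θ S (hS ▸ hθ.mate_mem_range)
  rw [hβ.sum_lenTerm hS] at hβlen
  rw [hθ.sum_lenTerm hS] at hθlen
  have hout : (∑ x, ∑ z, if x ∉ S ∧ z ∉ S then lenTerm θ.mate x z else 0) =
      ∑ x, ∑ z, if x ∉ S ∧ z ∉ S then lenTerm β.mate x z else 0 := by
    refine Finset.sum_congr rfl fun x _ => Finset.sum_congr rfl fun z _ => ?_
    split_ifs with h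
    · simp only [lenTerm, hm x h.1, hm z h.2]
    · rfl
  rw [hout] at hθlen
  have hsum := sub_eq_zero.2 (by linarith :
    (∑ z, if z ∉ S then (∑ x, if x ∈ S ∧ min z (θ.mate z) < x ∧ x < max z (θ.mate z)
        then 1 else 0) + 2 * θ.cover S (min z (θ.mate z)) (max z (θ.mate z)) else 0) =
    ∑ z, if z ∉ S then (∑ x, if x ∈ S ∧ min z (β.mate z) < x ∧ x < max z (β.mate z)
        then 1 else 0) + 2 * β.cover S (min z (β.mate z)) (max z (β.mate z)) else 0)
  rw [← Finset.sum_sub_distrib, Finset.sum_eq_zero_iff_of_nonneg] at hsum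
  · have h := hsum y (Finset.mem_univ y)
    rw [if_pos hy, if_pos hy, hm y hy] at h
    rw [cover_univ β S, cover_univ θ S, hcompl]
    linarith
  · intro z _
    by_cases hz : z ∈ S
    · simp [hz]
    · rw [if_pos hz, if_pos hz, hm z hz]
      linarith [hmono z]

end Clan

/-- in an interval pattern embedding `[α,γ] ↪ [β,θ]` via `ι`, at an unused
position `j` carrying a sign, the statistics `(j;+)` and `(j;-)` of `β` and `θ` agree. -/
theorem stat_sign_agree {p q r s : ℕ} (α γ : Clan p q) (β θ : Clan r s)
    (ι : Fin (p + q) → Fin (r + s))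
    (hαγ : Clan.ble α γ) (hβθ : Clan.ble β θ)
    (hemb : Clan.IntervalEmbed α γ β θ ι)
    (j : Fin (r + s)) (hj : ∀ k, ι k ≠ j) (hsign : β.mate j = j) :
    Clan.statPlus β ((j : ℕ) + 1) = Clan.statPlus θ ((j : ℕ) + 1) ∧
      Clan.statMinus β ((j : ℕ) + 1) = Clan.statMinus θ ((j : ℕ) + 1) := by
  have hcov := hemb.cover_eq hβθ (y := j) (fun ⟨k, hk⟩ => hj k hk)
  rw [hsign, min_self, max_self] at hcov
  have hθj : θ.mate j = j := (hemb.2.2.1 j hj).1 ▸ hsign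
  have hβ := β.signStat_add_cover j hsign
  have hθ := θ.signStat_add_cover j hθj
  have hp := Clan.signStat_anti hβθ true j
  have hm := Clan.signStat_anti hβθ false j
  rw [← Clan.statPlus_eq, ← Clan.statMinus_eq] at hβ hθ
  rw [← Clan.statPlus_eq, ← Clan.statPlus_eq] at hp
  rw [← Clan.statMinus_eq, ← Clan.statMinus_eq] at hm
  omega
end
end

section
/- Let α be a (p,q)-clan and let M_α(z) be the generic matrix of the space S_α, whose unspecialized entries are independent variables z (subject to the identifications (Z.9)), regarded as a matrix over the polynomial ring ℚ[z]. Then det M_α(z) is a nonzero constant, i.e., an element of ℚ \ {0}; in particular M_α(z) is invertible over ℚ[z]. -/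
noncomputable section
open scoped Classical

namespace Clan

variable {p q : ℕ}

/-- The number of elements of `S` strictly below `i`. -/
def rankIn {n : ℕ} (S : Fin n → Prop) (i : Fin n) : ℕ :=
  (Finset.univ.filter fun j : Fin n => S j ∧ j < i).card

theorem rankIn_lt_rankIn {n : ℕ} {S : Fin n → Prop} {i j : Fin n} (hi : S i) (hij : i < j) :
    rankIn S i < rankIn S j := by
  refine Finset.card_lt_card (Finset.ssubset_iff_of_subset ?_ |>.2 ⟨i, ?_, ?_⟩)
  · intro k hk
    simp only [Finset.mem_filter, Finset.mem_univ, true_and] at hk ⊢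
    exact ⟨hk.1, hk.2.trans hij⟩
  · simp [hi, hij]
  · simp

theorem rankIn_injOn {n : ℕ} {S : Fin n → Prop} {i j : Fin n} (hi : S i) (hj : S j)
    (h : rankIn S i = rankIn S j) : i = j := by
  rcases lt_trichotomy i j with hij | hij | hij
  · exact absurd h (rankIn_lt_rankIn hi hij).ne
  · exact hij
  · exact absurd h (rankIn_lt_rankIn hj hij).ne'

theorem rankIn_lt_card {n : ℕ} {S : Fin n → Prop} [DecidablePred S] {i : Fin n} (hi : S i) :
    rankIn S i < (Finset.univ.filter S).card := by
  refine Finset.card_lt_card (Finset.ssubset_iff_of_subset ?_ |>.2 ⟨i, ?_, ?_⟩)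
  · intro k hk
    simp only [Finset.mem_filter, Finset.mem_univ, true_and] at hk ⊢
    exact hk.1
  · simp [hi]
  · simp

theorem card_isRight (c : Clan p q) :
    (Finset.univ.filter c.IsRight).card = (Finset.univ.filter c.IsLeft).card := by
  refine Finset.card_bij' (fun i _ => c.mate i) (fun i _ => c.mate i) ?_ ?_ ?_ ?_ <;>
    simp [IsLeft, IsRight, c.mate_invol]

theorem isPlus_or (c : Clan p q) (i : Fin (p + q)) :
    c.IsPlus i ∨ c.IsMinus i ∨ c.IsLeft i ∨ c.IsRight i := by
  rcases lt_trichotomy i (c.mate i) with h | h | h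
  · exact .inr (.inr (.inl h))
  · cases hs : c.sign i
    · exact .inr (.inl ⟨h.symm, hs⟩)
    · exact .inl ⟨h.symm, hs⟩
  · exact .inr (.inr (.inr h))

theorem card_symbols (c : Clan p q) :
    (Finset.univ.filter fun i => c.IsPlus i ∨ c.IsLeft i).card = p ∧
      (Finset.univ.filter fun i => c.IsMinus i ∨ c.IsLeft i).card = q := by
  have hpl : (Finset.univ.filter fun i => c.IsPlus i ∨ c.IsLeft i).card =
      (Finset.univ.filter c.IsPlus).card + (Finset.univ.filter c.IsLeft).card := by
    rw [Finset.filter_or, Finset.card_union_of_disjoint]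
    exact Finset.disjoint_filter.2 fun i _ h h' => h'.ne' h.1
  have hml : (Finset.univ.filter fun i => c.IsMinus i ∨ c.IsLeft i).card =
      (Finset.univ.filter c.IsMinus).card + (Finset.univ.filter c.IsLeft).card := by
    rw [Finset.filter_or, Finset.card_union_of_disjoint]
    exact Finset.disjoint_filter.2 fun i _ h h' => h'.ne' h.1
  have hmr : (Finset.univ.filter fun i => c.IsMinus i ∨ c.IsRight i).card =
      (Finset.univ.filter c.IsMinus).card + (Finset.univ.filter c.IsRight).card := by
    rw [Finset.filter_or, Finset.card_union_of_disjoint]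
    exact Finset.disjoint_filter.2 fun i _ h h' => h'.ne h.1
  have hall : (Finset.univ.filter fun i => c.IsPlus i ∨ c.IsLeft i).card +
      (Finset.univ.filter fun i => c.IsMinus i ∨ c.IsRight i).card = p + q := by
    rw [← Finset.card_union_of_disjoint, ← Finset.filter_or, Finset.filter_true_of_mem]
    · simp
    · intro i _
      have := c.isPlus_or i
      tauto
    · refine Finset.disjoint_filter.2 fun i _ h h' => ?_
      rcases h with h | h <;> rcases h' with h' | h'
      · exact Bool.noConfusion (h.2.symm.trans h'.2)
      · exact h'.ne h.1
      · exact h.ne' h'.1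
      · exact lt_asymm h h'
  have hpm : (Finset.univ.filter c.IsPlus).card + q = (Finset.univ.filter c.IsMinus).card + p := by
    convert c.plus_minus using 3 <;> ext i <;> simp [IsPlus, IsMinus]
  have hlr := c.card_isRight
  omega

/-- The position at which the value of `w_c` at a `-` or a right end is assigned. -/
def anchor (c : Clan p q) (i : Fin (p + q)) : Fin (p + q) :=
  if c.IsMinus i then i else c.mate i

theorem wNat_of_plus_or_left (c : Clan p q) {i : Fin (p + q)} (h : c.IsPlus i ∨ c.IsLeft i) :
    c.wNat i = rankIn (fun j => c.IsPlus j ∨ c.IsLeft j) i :=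
  (if_pos h).trans <| by unfold rankIn; congr

theorem wNat_of_not_plus_or_left (c : Clan p q) {i : Fin (p + q)}
    (h : ¬(c.IsPlus i ∨ c.IsLeft i)) :
    c.wNat i = p + rankIn (fun j => c.IsMinus j ∨ c.IsLeft j) (c.anchor i) :=
  (if_neg h).trans <| by unfold rankIn; congr

theorem anchor_spec (c : Clan p q) {i : Fin (p + q)} (h : ¬(c.IsPlus i ∨ c.IsLeft i)) :
    c.IsMinus (c.anchor i) ∨ c.IsLeft (c.anchor i) := by
  by_cases hm : c.IsMinus i
  · simp [anchor, hm]
  · have hr : c.IsRight i := by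
      have := c.isPlus_or i
      tauto
    rw [anchor, if_neg hm]
    right
    simpa [IsLeft, c.mate_invol, IsRight] using hr

theorem anchor_injOn (c : Clan p q) {i j : Fin (p + q)} (h : c.anchor i = c.anchor j) :
    i = j := by
  by_cases hi : c.IsMinus i <;> by_cases hj : c.IsMinus j <;>
    simp only [anchor, hi, hj, if_true, if_false] at h
  · exact h
  · rw [← c.mate_invol j, ← h, hi.1]
  · rw [← c.mate_invol i, h, hj.1]
  · rw [← c.mate_invol i, h, c.mate_invol]

theorem wNat_lt (c : Clan p q) (i : Fin (p + q)) : c.wNat i < p + q := by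
  by_cases h : c.IsPlus i ∨ c.IsLeft i
  · rw [c.wNat_of_plus_or_left h]
    have := rankIn_lt_card (S := fun j => c.IsPlus j ∨ c.IsLeft j) h
    have := c.card_symbols.1
    omega
  · rw [c.wNat_of_not_plus_or_left h]
    have := rankIn_lt_card (S := fun j => c.IsMinus j ∨ c.IsLeft j) (c.anchor_spec h)
    have := c.card_symbols.2
    omega

theorem wNat_lt_iff (c : Clan p q) (i : Fin (p + q)) :
    c.wNat i < p ↔ c.IsPlus i ∨ c.IsLeft i := by
  by_cases h : c.IsPlus i ∨ c.IsLeft i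
  · have := rankIn_lt_card (S := fun j => c.IsPlus j ∨ c.IsLeft j) h
    rw [c.card_symbols.1] at this
    simpa [c.wNat_of_plus_or_left h, h] using this
  · simp [c.wNat_of_not_plus_or_left h, h]

theorem wNat_injective (c : Clan p q) : Function.Injective c.wNat := by
  intro i j hij
  have hiff : (c.IsPlus i ∨ c.IsLeft i) ↔ (c.IsPlus j ∨ c.IsLeft j) := by
    rw [← c.wNat_lt_iff, ← c.wNat_lt_iff, hij]
  by_cases h : c.IsPlus i ∨ c.IsLeft i
  · have h' := hiff.1 h
    rw [c.wNat_of_plus_or_left h, c.wNat_of_plus_or_left h'] at hij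
    exact rankIn_injOn h h' hij
  · have h' := fun hj => h (hiff.2 hj)
    rw [c.wNat_of_not_plus_or_left h, c.wNat_of_not_plus_or_left h'] at hij
    exact c.anchor_injOn (rankIn_injOn (S := fun j => c.IsMinus j ∨ c.IsLeft j)
      (c.anchor_spec h) (c.anchor_spec h') (by omega))

/-- The permutation `w_c` of `Fin (p + q)`. -/
def wPerm (c : Clan p q) : Equiv.Perm (Fin (p + q)) :=
  Equiv.ofBijective (fun i => ⟨c.wNat i, c.wNat_lt i⟩) <| Finite.injective_iff_bijective.1
    fun _ _ h => c.wNat_injective (Fin.mk.inj h)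

@[simp]
theorem wPerm_val (c : Clan p q) (i : Fin (p + q)) : (c.wPerm i : ℕ) = c.wNat i :=
  rfl

/-- The unipotent matrix subtracting, for each matching, the column indexed by its left end from
the column indexed by its right end. -/
def elimMatrix (c : Clan p q) : Matrix (Fin (p + q)) (Fin (p + q)) ℂ :=
  1 - Matrix.of fun x y => if c.IsRight y ∧ x = c.mate y then 1 else 0

theorem det_elimMatrix (c : Clan p q) : c.elimMatrix.det = 1 := by
  rw [Matrix.det_of_isUpperTriangular]
  · refine Finset.prod_eq_one fun i _ => ?_
    have : ¬(c.IsRight i ∧ i = c.mate i) := fun h => h.1.ne h.2.symm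
    simp [elimMatrix, this]
  · intro x y hyx
    have hyx : y < x := hyx
    have : ¬(c.IsRight y ∧ x = c.mate y) := fun h => lt_asymm hyx (h.2 ▸ h.1)
    simp [elimMatrix, this, hyx.ne']

theorem mul_elimMatrix_apply (c : Clan p q) (N : Matrix (Fin (p + q)) (Fin (p + q)) ℂ)
    (x y : Fin (p + q)) :
    (N * c.elimMatrix) x y = N x y - if c.IsRight y then N x (c.mate y) else 0 := by
  rw [elimMatrix, mul_sub, mul_one, Matrix.sub_apply, Matrix.mul_apply]
  by_cases h : c.IsRight y <;> simp [h]

theorem isMatch_of_isRight (c : Clan p q) {y : Fin (p + q)} (h : c.IsRight y) :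
    c.IsMatch (c.mate y) y :=
  ⟨h, c.mate_invol y⟩

theorem MemS.mul_elimMatrix_apply_of_lt {c : Clan p q}
    {M : Matrix (Fin (p + q)) (Fin (p + q)) ℂ} (hM : MemS c M) {x y : Fin (p + q)}
    (hxy : x < y) : (M.submatrix id c.wPerm * c.elimMatrix) x y = 0 := by
  obtain ⟨-, o2, -, -, -, z2, z3, -, -, -, z6, z6', z7, -, -⟩ := hM
  rw [mul_elimMatrix_apply]
  simp only [Matrix.submatrix_apply, id]
  by_cases hr : c.IsRight y
  · have hm := c.isMatch_of_isRight hr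
    rw [if_pos hr]
    rcases lt_trichotomy x (c.mate y) with h | h | h
    · have hl : c.IsLeft (c.mate y) := by simpa [IsLeft, c.mate_invol, IsRight] using hr
      rw [z6' _ _ x _ hm (c.wPerm_val y) h, z2 _ x _ (.inr hl) (c.wPerm_val _) h, sub_zero]
    · rw [h, o2 _ _ _ hm (.inr (c.wPerm_val y)), o2 _ _ _ hm (.inl (c.wPerm_val _)), sub_self]
    · rw [z7 _ _ x _ hm (c.wPerm_val y) h hxy, z3 _ _ x _ hm (c.wPerm_val _) h hxy, sub_zero]
  · rw [if_neg hr, sub_zero]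
    rcases c.isPlus_or y with h | h | h | h
    · exact z2 _ x _ (.inl h) (c.wPerm_val y) hxy
    · exact z6 _ x _ h (c.wPerm_val y) hxy
    · exact z2 _ x _ (.inr h) (c.wPerm_val y) hxy
    · exact absurd h hr

theorem MemS.mul_elimMatrix_apply_self {c : Clan p q}
    {M : Matrix (Fin (p + q)) (Fin (p + q)) ℂ} (hM : MemS c M) (x : Fin (p + q)) :
    (M.submatrix id c.wPerm * c.elimMatrix) x x = if c.IsRight x then 2 else 1 := by
  obtain ⟨o1, o2, o3, o3', -⟩ := hM
  rw [mul_elimMatrix_apply]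
  simp only [Matrix.submatrix_apply, id]
  by_cases hr : c.IsRight x
  · have hm := c.isMatch_of_isRight hr
    rw [if_pos hr, if_pos hr, o3' _ _ _ hm (c.wPerm_val x), o3 _ _ _ hm (c.wPerm_val _)]
    norm_num
  · rw [if_neg hr, if_neg hr, sub_zero]
    rcases c.isPlus_or x with h | h | h | h
    · exact o1 _ _ h.1 (c.wPerm_val x)
    · exact o1 _ _ h.1 (c.wPerm_val x)
    · exact o2 _ _ _ ⟨h, rfl⟩ (.inl (c.wPerm_val x))
    · exact absurd h hr

theorem MemS.sign_mul_det {c : Clan p q} {M : Matrix (Fin (p + q)) (Fin (p + q)) ℂ}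
    (hM : MemS c M) :
    ((Equiv.Perm.sign c.wPerm : ℤ) : ℂ) * M.det = 2 ^ (Finset.univ.filter c.IsRight).card := by
  rw [← Matrix.det_permute', ← mul_one (Matrix.det _), ← c.det_elimMatrix, ← Matrix.det_mul,
    Matrix.det_of_isLowerTriangular _ fun _ _ h => hM.mul_elimMatrix_apply_of_lt h]
  simp [hM.mul_elimMatrix_apply_self, Finset.prod_ite]

end Clan

/-- the determinant of the generic matrix of `S_α` is a nonzero rational
constant: there is a nonzero `d ∈ ℚ` with `det M = d` for every member `M` of `S_α`;
in particular every such `M` is invertible. -/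
theorem det_of_slice_is_nonzero_constant {p q : ℕ} (α : Clan p q) :
    ∃ d : ℚ, d ≠ 0 ∧
      ∀ M : Matrix (Fin (p + q)) (Fin (p + q)) ℂ, Clan.MemS α M → M.det = (d : ℂ) := by
  refine ⟨((Equiv.Perm.sign α.wPerm : ℤ) : ℚ) * 2 ^ (Finset.univ.filter α.IsRight).card, ?_, ?_⟩
  · simp
  · intro M hM
    push_cast
    rw [← hM.sign_mul_det, ← mul_assoc, ← Int.cast_mul, Int.units_coe_mul_self, Int.cast_one,
      one_mul]
end
end
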